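/- arXiv:math/0703898 — 2 statements merged into one kernel-verified Lean document; each statement's English description precedes it below -/
import Mathlib

section
/- For all integers p, q ≥ 0 the following four equivalences of patterns hold: (1) 1232ᵖ142^q ∼ 12312ᵖ42^q; (2) 1232ᵖ412^q ∼ 1232ᵖ42^q1; (3) 123^{p+1}413^q ∼ 12343ᵖ13^q; (4) 123^{p+1}143^q ∼ 123^{p+1}13^q4. -/
/-- `π` is the canonical sequence of a set partition: every entry is at least 1,
and each entry is at most one more than the maximum of the preceding entries
(so the first entry is 1). -/
def IsCanonicalSeq (π : List ℕ) : Prop :=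
  ∀ i (h : i < π.length), 1 ≤ π.get ⟨i, h⟩ ∧ π.get ⟨i, h⟩ ≤ (π.take i).foldr max 0 + 1

/-- `π` contains the pattern `σ`: there is a subsequence of `π`
order-isomorphic to `σ`. -/
def ContainsPat (π σ : List ℕ) : Prop :=
  ∃ f : Fin σ.length → Fin π.length, StrictMono f ∧
    ∀ i j : Fin σ.length, σ.get i < σ.get j ↔ π.get (f i) < π.get (f j)

/-- `π` avoids the pattern `σ`. -/
def AvoidsPat (π σ : List ℕ) : Prop := ¬ ContainsPat π σ

/-- `pAvoid n σ` is the number of canonical sequences of partitions of `[n]`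
avoiding the pattern `σ`. -/
noncomputable def pAvoid (n : ℕ) (σ : List ℕ) : ℕ :=
  Set.ncard {π : List ℕ | π.length = n ∧ IsCanonicalSeq π ∧ AvoidsPat π σ}

/-- Two patterns are equivalent if they have the same number of avoiders of
each size. -/
def PatEquiv (σ σ' : List ℕ) : Prop := ∀ n, pAvoid n σ = pAvoid n σ'

/-- The increasing sequence `1, 2, …, k`. -/
def iota (k : ℕ) : List ℕ := (List.range k).map (· + 1)

/-- A block of `n` sites of which only the last one is flagged. -/
def flagBlock : ℕ → List Bool
  | 0 => []
  | n + 1 => List.replicate n false ++ [true]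

/-- Whether, for the flagged sites `c` receiving `y` new letters, some non-final flagged site
is followed by at least `q` new letters. -/
def isActive (q : ℕ) : List Bool → List ℕ → Bool
  | b :: b' :: c, _ :: y => (b && decide (q ≤ y.sum)) || isActive q (b' :: c) y
  | _, _ => false

/-- The numbers of new letters received by the active sites, which form an initial segment. -/
def activePart (q : ℕ) : List Bool → List ℕ → List ℕ
  | b :: c, x :: y => if isActive q (b :: c) (x :: y) then x :: activePart q c y else []
  | _, _ => []

/-- Numbers of sites surviving at each old site if every active site preceded by `p` new
letters dies, where `n` letters have already been seen. -/
def sizesLeft (p q : ℕ) : ℕ → List Bool → List ℕ → List ℕ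
  | n, b :: c, x :: y =>
    (if isActive q (b :: c) (x :: y) then min (x + 1) (p - n) else x + 1) ::
      sizesLeft p q (n + x) c y
  | _, _, _ => []

/-- Numbers of sites surviving at each old site if every active site followed by `p` new
letters in the active part dies. -/
def sizesRight (p q : ℕ) : List Bool → List ℕ → List ℕ
  | b :: c, x :: y =>
    (if isActive q (b :: c) (x :: y) then min (x + 1) (p - (activePart q c y).sum) else x + 1) ::
      sizesRight p q c y
  | _, _ => []

/-- The survivors in a list all of whose sites are active, counting letters from the left. -/
def survLeft : ℕ → List ℕ → List ℕ
  | _, [] => []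
  | p, x :: l => min (x + 1) p :: survLeft (p - x) l

/-- The survivors in a list all of whose sites are active, counting letters from the right. -/
def survRight (p : ℕ) : List ℕ → List ℕ
  | [] => []
  | x :: l => min (x + 1) (p - l.sum) :: survRight p l

theorem isActive_cons {q : ℕ} {b x c y} (h : isActive q c y = true) :
    isActive q (b :: c) (x :: y) = true := by
  cases c with
  | nil => simp [isActive] at h
  | cons b' c => simp [isActive, h]

theorem activePart_eq_nil {q : ℕ} {c y} (h : isActive q c y = false) : activePart q c y = [] := by
  cases c <;> cases y <;> simp_all [activePart]

theorem activePart_ne_nil {q : ℕ} {c y} (h : isActive q c y = true) : activePart q c y ≠ [] := by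
  cases c <;> cases y <;> simp_all [activePart, isActive]

theorem isActive_iff {q : ℕ} {c y} : isActive q c y = true ↔ activePart q c y ≠ [] := by
  refine ⟨activePart_ne_nil, fun h => ?_⟩
  by_contra h'
  exact h (activePart_eq_nil (by simpa using h'))

theorem activePart_append_drop (q : ℕ) (c : List Bool) (y : List ℕ) :
    activePart q c y ++ y.drop (activePart q c y).length = y := by
  induction c generalizing y with
  | nil => simp [activePart]
  | cons b c ih =>
    cases y with
    | nil => simp [activePart]
    | cons x y =>
      rw [activePart]
      split_ifs
      · simpa using ih y
      · simp

theorem activePart_replace {q : ℕ} {c : List Bool} {l₀ t l : List ℕ}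
    (h : activePart q c (l₀ ++ t) = l₀) (hl : l.length = l₀.length) :
    activePart q c (l ++ t) = l := by
  induction c generalizing l₀ l with
  | nil =>
    simp only [activePart] at h
    subst h
    simpa [activePart] using hl
  | cons b c ih =>
    cases l₀ with
    | nil => rw [List.length_eq_zero_iff.mp hl, h]
    | cons x l₀ =>
      cases l with
      | nil => simp at hl
      | cons x' l =>
        simp only [List.cons_append, activePart] at h ⊢
        split_ifs at h with h1
        simp only [List.cons.injEq, true_and] at h
        have ih' := ih h (by simpa using hl)
        rw [if_pos, ih']
        cases l₀ with
        | nil =>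
          obtain rfl : l = [] := by simpa using hl
          cases c <;> simp_all [isActive]
        | cons z l₀ =>
          apply isActive_cons
          rw [isActive_iff, ih']
          intro h0
          simp [h0] at hl

theorem sizesLeft_inactive {p q n : ℕ} {c y} (hc : c.length = y.length)
    (h : isActive q c y = false) : sizesLeft p q n c y = y.map (· + 1) := by
  induction c generalizing n y with
  | nil => cases y <;> simp_all [sizesLeft]
  | cons b c ih =>
    cases y with
    | nil => simp at hc
    | cons x y =>
      have : isActive q c y = false := by
        by_contra h'
        simp [isActive_cons (by simpa using h')] at h
      simp [sizesLeft, h, ih (by simpa using hc) this]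

theorem sizesRight_inactive {p q : ℕ} {c y} (hc : c.length = y.length)
    (h : isActive q c y = false) : sizesRight p q c y = y.map (· + 1) := by
  induction c generalizing y with
  | nil => cases y <;> simp_all [sizesRight]
  | cons b c ih =>
    cases y with
    | nil => simp at hc
    | cons x y =>
      have : isActive q c y = false := by
        by_contra h'
        simp [isActive_cons (by simpa using h')] at h
      simp [sizesRight, h, ih (by simpa using hc) this]

theorem sizesLeft_eq {p q n : ℕ} {c y} (hc : c.length = y.length) :
    sizesLeft p q n c y =
      survLeft (p - n) (activePart q c y) ++
        (y.drop (activePart q c y).length).map (· + 1) := by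
  induction c generalizing n y with
  | nil => cases y <;> simp_all [sizesLeft, activePart, survLeft]
  | cons b c ih =>
    cases y with
    | nil => simp at hc
    | cons x y =>
      by_cases h : isActive q (b :: c) (x :: y) = true
      · simp [sizesLeft, activePart, h, survLeft, ih (n := n + x) (y := y) (by simpa using hc),
          Nat.sub_sub]
      · rw [sizesLeft_inactive hc (by simpa using h), activePart_eq_nil (by simpa using h)]
        simp [survLeft]

theorem sizesRight_eq {p q : ℕ} {c y} (hc : c.length = y.length) :
    sizesRight p q c y =
      survRight p (activePart q c y) ++ (y.drop (activePart q c y).length).map (· + 1) := by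
  induction c generalizing y with
  | nil => cases y <;> simp_all [sizesRight, activePart, survRight]
  | cons b c ih =>
    cases y with
    | nil => simp at hc
    | cons x y =>
      by_cases h : isActive q (b :: c) (x :: y) = true
      · simp [sizesRight, activePart, h, survRight, ih (y := y) (by simpa using hc)]
      · rw [sizesRight_inactive hc (by simpa using h), activePart_eq_nil (by simpa using h)]
        simp [survRight]

theorem survLeft_append (p : ℕ) (l l' : List ℕ) :
    survLeft p (l ++ l') = survLeft p l ++ survLeft (p - l.sum) l' := by
  induction l generalizing p with
  | nil => simp [survLeft]
  | cons x l ih => simp [survLeft, ih, Nat.sub_sub]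

theorem survRight_eq (p : ℕ) (l : List ℕ) :
    survRight p l = (survLeft p l.reverse).reverse := by
  induction l with
  | nil => simp [survRight, survLeft]
  | cons x l ih => simp [survRight, survLeft_append, ih, survLeft]

/-- The nonzero survivors of a list of sum at least `p`, and what remains of the list. -/
def cutAt : ℕ → List ℕ → List ℕ × List ℕ
  | _, [] => ([], [])
  | p, x :: l => if x < p then ((x + 1) :: (cutAt (p - x) l).1, (cutAt (p - x) l).2)
      else ([p], (x - p) :: l)

/-- Inverse of `cutAt`. -/
def glue : List ℕ → List ℕ → List ℕ
  | [], r => r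
  | [c], r => (c + r.headD 0) :: r.tail
  | c :: c' :: s, r => (c - 1) :: glue (c' :: s) r

theorem glue_cons {c : ℕ} {s r : List ℕ} (hs : s ≠ []) : glue (c :: s) r = (c - 1) :: glue s r := by
  cases s with
  | nil => exact absurd rfl hs
  | cons => rfl

/-- The property of a pair to be a value of `cutAt p`. -/
structure IsCut (p : ℕ) (s r : List ℕ) : Prop where
  s_ne : s ≠ []
  r_ne : r ≠ []
  pos : ∀ c ∈ s, 0 < c
  sum_s : s.sum + 1 = p + s.length

theorem IsCut.reverse {p s r} (h : IsCut p s r) : IsCut p s.reverse r where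
  s_ne := by simpa using h.s_ne
  r_ne := h.r_ne
  pos := by simpa using h.pos
  sum_s := by simpa using h.sum_s

theorem IsCut.tail {p c s r} (h : IsCut p (c :: s) r) (hs : s ≠ []) :
    IsCut (p - (c - 1)) s r ∧ 0 < c ∧ c ≤ p := by
  have hc := h.pos c (by simp)
  have h1 := h.sum_s
  have hpos : ∀ c ∈ s, 0 < c := fun c hc => h.pos c (by simp [hc])
  have h2 : s.length ≤ s.sum := by
    simpa using List.card_nsmul_le_sum s 1 (fun c hc => hpos c hc)
  simp only [List.sum_cons, List.length_cons] at h1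
  exact ⟨⟨hs, h.r_ne, hpos, by omega⟩, hc, by omega⟩

theorem isCut_cutAt {p : ℕ} {l : List ℕ} (hp : 0 < p) (hl : p ≤ l.sum) :
    IsCut p (cutAt p l).1 (cutAt p l).2 ∧ glue (cutAt p l).1 (cutAt p l).2 = l ∧
      (survLeft p l).filter (0 < ·) = (cutAt p l).1 := by
  induction l generalizing p with
  | nil => simp at hl; omega
  | cons x l ih =>
    simp only [cutAt, survLeft]
    split_ifs with hx
    · obtain ⟨h1, h2, h3⟩ := ih (p := p - x) (by omega) (by simp at hl; omega)
      refine ⟨⟨by simp, h1.r_ne, ?_, ?_⟩, ?_, ?_⟩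
      · simpa using h1.pos
      · have := h1.sum_s
        simp only [List.sum_cons, List.length_cons]
        omega
      · simp only [glue_cons h1.s_ne, h2]
        simp
      · rw [List.filter_cons_of_pos (by simp; omega), h3]
        congr 1
        omega
    · have h0 : p - x = 0 := by omega
      have hz : ∀ l : List ℕ, (survLeft 0 l).filter (0 < ·) = [] := by
        intro l
        induction l with
        | nil => simp [survLeft]
        | cons y l ih => simp [survLeft, ih]
      refine ⟨⟨by simp, by simp, by simpa using hp, by simp⟩, ?_, ?_⟩
      · simp [glue]; omega
      · rw [List.filter_cons_of_pos (by simp; omega), h0, hz]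
        congr 1
        omega

theorem cutAt_glue {p s r} (h : IsCut p s r) : cutAt p (glue s r) = (s, r) := by
  induction s generalizing p with
  | nil => exact absurd rfl h.s_ne
  | cons c s ih =>
    by_cases hs : s = []
    · subst hs
      obtain ⟨z, r, rfl⟩ := List.exists_cons_of_ne_nil h.r_ne
      have := h.sum_s
      simp only [List.sum_cons, List.sum_nil, List.length_cons, List.length_nil] at this
      obtain rfl : c = p := by omega
      simp [glue, cutAt]
    · obtain ⟨h1, h2, h3⟩ := h.tail hs
      rw [glue_cons hs, cutAt, if_pos (by omega), ih h1]
      simp; omega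

theorem sum_glue {p s r} (h : IsCut p s r) : (glue s r).sum = p + r.sum := by
  induction s generalizing p with
  | nil => exact absurd rfl h.s_ne
  | cons c s ih =>
    by_cases hs : s = []
    · subst hs
      obtain ⟨z, r, rfl⟩ := List.exists_cons_of_ne_nil h.r_ne
      have := h.sum_s
      simp only [List.sum_cons, List.sum_nil, List.length_cons, List.length_nil] at this
      simp [glue]; omega
    · obtain ⟨h1, h2, h3⟩ := h.tail hs
      rw [glue_cons hs, List.sum_cons, ih h1]
      omega

theorem length_glue {s r : List ℕ} (hs : s ≠ []) (hr : r ≠ []) :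
    (glue s r).length + 1 = s.length + r.length := by
  induction s with
  | nil => exact absurd rfl hs
  | cons c s ih =>
    by_cases hs : s = []
    · subst hs
      obtain ⟨z, r, rfl⟩ := List.exists_cons_of_ne_nil hr
      simp [glue]; omega
    · rw [glue_cons hs, List.length_cons, List.length_cons, ih hs]
      omega

/-- An involution reversing the list of nonzero survivors. -/
def flipCut (p : ℕ) (l : List ℕ) : List ℕ :=
  if 0 < p ∧ p ≤ l.sum then glue (cutAt p l).1.reverse (cutAt p l).2 else l.reverse

theorem sum_flipCut (p : ℕ) (l : List ℕ) : (flipCut p l).sum = l.sum := by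
  rw [flipCut]
  split_ifs with h
  · obtain ⟨h1, h2, -⟩ := isCut_cutAt h.1 h.2
    rw [sum_glue h1.reverse, ← sum_glue h1, h2]
  · exact List.sum_reverse l

theorem length_flipCut (p : ℕ) (l : List ℕ) : (flipCut p l).length = l.length := by
  rw [flipCut]
  split_ifs with h
  · obtain ⟨h1, h2, -⟩ := isCut_cutAt h.1 h.2
    have h3 := length_glue h1.s_ne h1.r_ne
    have h4 := length_glue h1.reverse.s_ne h1.r_ne
    rw [h2] at h3
    rw [List.length_reverse] at h4
    omega
  · simp

theorem flipCut_flipCut (p : ℕ) (l : List ℕ) : flipCut p (flipCut p l) = l := by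
  rw [flipCut, sum_flipCut]
  split_ifs with h
  · obtain ⟨h1, h2, -⟩ := isCut_cutAt h.1 h.2
    rw [flipCut, if_pos h, cutAt_glue h1.reverse]
    simpa using h2
  · rw [flipCut, if_neg h, List.reverse_reverse]

/-- The flags of consecutive blocks of sites of the given sizes. -/
def render (ns : List ℕ) : List Bool := ns.flatMap flagBlock

theorem render_cons (n : ℕ) (l : List ℕ) : render (n :: l) = flagBlock n ++ render l := rfl

theorem render_append (l l' : List ℕ) : render (l ++ l') = render l ++ render l' := by
  simp [render]

theorem render_filter (ns : List ℕ) : render (ns.filter (0 < ·)) = render ns := by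
  induction ns with
  | nil => rfl
  | cons x l ih =>
    rcases Nat.eq_zero_or_pos x with rfl | hx
    · simpa [render, flagBlock] using ih
    · simpa [render, hx] using ih

theorem survLeft_zero (l : List ℕ) : survLeft 0 l = List.replicate l.length 0 := by
  induction l with
  | nil => rfl
  | cons x l ih => simp [survLeft, ih, List.replicate_succ]

theorem survLeft_of_sum_lt {p : ℕ} {l : List ℕ} (h : l.sum < p) :
    survLeft p l = l.map (· + 1) := by
  induction l generalizing p with
  | nil => rfl
  | cons x l ih =>
    rw [List.sum_cons] at h
    rw [survLeft, ih (by omega), List.map_cons]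
    congr 1
    omega

theorem render_survLeft_flipCut (p : ℕ) (l : List ℕ) :
    render (survLeft p (flipCut p l)) = render (survLeft p l).reverse := by
  by_cases h : 0 < p ∧ p ≤ l.sum
  · have h' : p ≤ (flipCut p l).sum := (sum_flipCut p l).symm ▸ h.2
    rw [← render_filter, ← render_filter (List.reverse _), List.filter_reverse,
      (isCut_cutAt h.1 h').2.2, (isCut_cutAt h.1 h.2).2.2, flipCut, if_pos h,
      cutAt_glue (isCut_cutAt h.1 h.2).1.reverse]
  · rw [flipCut, if_neg h]
    rcases Nat.eq_zero_or_pos p with rfl | hp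
    · simp [survLeft_zero]
    · have : l.sum < p := by
        by_contra h'
        exact h ⟨hp, by omega⟩
      rw [survLeft_of_sum_lt (by simpa using this), survLeft_of_sum_lt this, List.map_reverse]

/-- Numbers of surviving sites, for either way of counting the letters. -/
def sizes (p q : ℕ) (v : Bool) (c : List Bool) (y : List ℕ) : List ℕ :=
  if v then sizesRight p q c y else sizesLeft p q 0 c y

/-- The rearrangement of inserted letters that exchanges the two ways of counting. -/
def rearrange (p q : ℕ) (v : Bool) (c : List Bool) (y : List ℕ) : List ℕ :=
  (if v then flipCut p (activePart q c y).reverse else (flipCut p (activePart q c y)).reverse) ++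
    y.drop (activePart q c y).length

theorem activePart_rearrange (p q : ℕ) (v : Bool) (c : List Bool) (y : List ℕ) :
    activePart q c (rearrange p q v c y) =
      if v then flipCut p (activePart q c y).reverse
      else (flipCut p (activePart q c y)).reverse := by
  have h := activePart_append_drop q c y
  refine activePart_replace (l₀ := activePart q c y) (by rw [h]) ?_
  cases v <;> simp [length_flipCut]

theorem length_activePart_rearrange (p q : ℕ) (v : Bool) (c : List Bool) (y : List ℕ) :
    (activePart q c (rearrange p q v c y)).length = (activePart q c y).length := by
  rw [activePart_rearrange]
  cases v <;> simp [length_flipCut]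

theorem drop_rearrange (p q : ℕ) (v : Bool) (c : List Bool) (y : List ℕ) :
    (rearrange p q v c y).drop (activePart q c y).length =
      y.drop (activePart q c y).length := by
  rw [rearrange, List.drop_left']
  cases v <;> simp [length_flipCut]

theorem length_rearrange (p q : ℕ) (v : Bool) (c : List Bool) (y : List ℕ) :
    (rearrange p q v c y).length = y.length := by
  conv_rhs => rw [← activePart_append_drop q c y]
  cases v <;> simp only [rearrange, List.length_append, length_flipCut, List.length_reverse,
    if_true, Bool.false_eq_true, if_false]

theorem sum_rearrange (p q : ℕ) (v : Bool) (c : List Bool) (y : List ℕ) :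
    (rearrange p q v c y).sum = y.sum := by
  conv_rhs => rw [← activePart_append_drop q c y]
  cases v <;> simp only [rearrange, List.sum_append, sum_flipCut, List.sum_reverse,
    if_true, Bool.false_eq_true, if_false]

theorem rearrange_rearrange (p q : ℕ) (v : Bool) (c : List Bool) (y : List ℕ) :
    rearrange p q (!v) c (rearrange p q v c y) = y := by
  conv_rhs => rw [← activePart_append_drop q c y]
  rw [rearrange, length_activePart_rearrange, drop_rearrange, activePart_rearrange]
  cases v <;> simp [flipCut_flipCut]

theorem render_sizes_rearrange (p q : ℕ) (v : Bool) {c : List Bool} {y : List ℕ}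
    (hc : c.length = y.length) :
    render (sizes p q (!v) c (rearrange p q v c y)) = render (sizes p q v c y) := by
  have hc' : c.length = (rearrange p q v c y).length := by rw [length_rearrange, hc]
  have h1 := length_activePart_rearrange p q v c y
  have h2 := drop_rearrange p q v c y
  have h3 := activePart_rearrange p q v c y
  cases v
  · simp only [sizes, Bool.not_false, if_true, Bool.false_eq_true, if_false] at *
    rw [sizesRight_eq hc', sizesLeft_eq hc, h1, h2, h3, render_append, render_append, survRight_eq,
      List.reverse_reverse, Nat.sub_zero]
    congr 1
    have h4 := render_survLeft_flipCut p (flipCut p (activePart q c y))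
    rw [flipCut_flipCut] at h4
    exact h4.symm
  · simp only [sizes, Bool.not_true, if_true, Bool.false_eq_true, if_false] at *
    rw [sizesRight_eq hc, sizesLeft_eq hc', h1, h2, h3, render_append, render_append, survRight_eq,
      Nat.sub_zero, render_survLeft_flipCut]

/-- The letters of a marked word, in which `none` marks an available gap. -/
def word (T : List (Option ℕ)) : List ℕ := T.reduceOption

@[simp] theorem word_nil : word [] = [] := rfl

@[simp] theorem word_none (T : List (Option ℕ)) : word (none :: T) = word T := rfl

@[simp] theorem word_some (a : ℕ) (T : List (Option ℕ)) : word (some a :: T) = a :: word T := rfl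

@[simp] theorem word_append (T T' : List (Option ℕ)) : word (T ++ T') = word T ++ word T' := by
  simp [word, List.reduceOption_append]

/-- A block of `x` letters `m`, each followed by a gap. -/
def block (m : ℕ) : ℕ → List (Option ℕ)
  | 0 => []
  | x + 1 => some m :: none :: block m x

/-- Insert the given numbers of letters `m` at the gaps. -/
def ins (m : ℕ) : List (Option ℕ) → List ℕ → List (Option ℕ)
  | none :: D, x :: y => none :: (block m x ++ ins m D y)
  | none :: D, [] => none :: ins m D []
  | some a :: D, y => some a :: ins m D y
  | [], _ => []

open Classical in
/-- Remove the gaps at which `K` holds of the letters before and after the gap. -/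
noncomputable def prune (K : List ℕ → List ℕ → Prop) :
    List ℕ → List (Option ℕ) → List ℕ → List (Option ℕ)
  | _, [], _ => []
  | pre, some a :: T, post => some a :: prune K (pre ++ [a]) T post
  | pre, none :: T, post =>
    if K pre (word T ++ post) then prune K pre T post else none :: prune K pre T post

/-- Whether a letter other than `m` occurs before the next gap, or there is no further gap. -/
def leads (m : ℕ) : List (Option ℕ) → Bool
  | [] => true
  | none :: _ => false
  | some a :: T => a != m || leads m T

/-- The flags of the gaps: whether a letter other than `m` occurs before the next gap. -/
def flags (m : ℕ) : List (Option ℕ) → List Bool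
  | [] => []
  | none :: T => leads m T :: flags m T
  | some _ :: T => flags m T

/-- The marked word ends with a gap and has no two adjacent gaps. -/
inductive Spaced : List (Option ℕ) → Prop
  | gap : Spaced [none]
  | letter (a : ℕ) {T : List (Option ℕ)} : Spaced T → Spaced (some a :: T)
  | gap_letter (a : ℕ) {T : List (Option ℕ)} :
      Spaced (some a :: T) → Spaced (none :: some a :: T)

/-- A letter `o` with `o + 1 < m` followed by `q` letters `m` occurs in the word. -/
def HasLow (m q z : ℕ) (w : List ℕ) : Prop :=
  ∃ o, o + 1 < m ∧ (List.replicate z m ++ o :: List.replicate q m).Sublist w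

/-- The condition for a gap between `pre` and `post` to become unavailable. -/
def Kills (p q : ℕ) (v : Bool) (m : ℕ) (pre post : List ℕ) : Prop :=
  if v then HasLow m q p post else p ≤ pre.count m ∧ HasLow m q 0 post

theorem word_block (m x : ℕ) : word (block m x) = List.replicate x m := by
  induction x with
  | zero => rfl
  | succ x ih => simp [block, ih, List.replicate_succ]

theorem prune_none_pos {K : List ℕ → List ℕ → Prop} {pre post : List ℕ} {T : List (Option ℕ)}
    (h : K pre (word T ++ post)) : prune K pre (none :: T) post = prune K pre T post := by
  rw [prune, if_pos h]

theorem prune_none_neg {K : List ℕ → List ℕ → Prop} {pre post : List ℕ} {T : List (Option ℕ)}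
    (h : ¬ K pre (word T ++ post)) :
    prune K pre (none :: T) post = none :: prune K pre T post := by
  rw [prune, if_neg h]

theorem prune_append (K : List ℕ → List ℕ → Prop) (pre : List ℕ) (X Y : List (Option ℕ))
    (post : List ℕ) : prune K pre (X ++ Y) post =
      prune K pre X (word Y ++ post) ++ prune K (pre ++ word X) Y post := by
  induction X generalizing pre with
  | nil => simp [prune]
  | cons t X ih =>
    cases t with
    | none =>
      rw [List.cons_append]
      by_cases h : K pre (word (X ++ Y) ++ post)
      · rw [prune_none_pos h, prune_none_pos (by simpa using h), ih, word_none]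
      · rw [prune_none_neg h, prune_none_neg (by simpa using h), ih, word_none, List.cons_append]
    | some a => simp [prune, ih]

theorem leads_append_of_gap (m : ℕ) (X Y : List (Option ℕ)) :
    leads m (X ++ none :: Y) = leads m (X ++ [none]) := by
  induction X with
  | nil => rfl
  | cons t X ih => cases t <;> simp [leads, ih]

theorem leads_append_some {m a : ℕ} (h : a ≠ m) (X Y : List (Option ℕ)) :
    leads m (X ++ some a :: Y) = leads m X := by
  induction X with
  | nil => simp [leads, h]
  | cons t X ih => cases t <;> simp [leads, ih]

theorem flags_append_some {m a : ℕ} (h : a ≠ m) (X Y : List (Option ℕ)) :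
    flags m (X ++ some a :: Y) = flags m X ++ flags m Y := by
  induction X with
  | nil => simp [flags]
  | cons t X ih => cases t <;> simp [flags, ih, leads_append_some h]

theorem length_flags (m : ℕ) (X : List (Option ℕ)) : (flags m X).length = X.count none := by
  induction X with
  | nil => rfl
  | cons t X ih => cases t <;> simp [flags, ih]

theorem leads_of_forall {m : ℕ} {X : List (Option ℕ)} (h : ∀ t ∈ X, t = none ∨ t = some m) :
    leads m X = decide (X.count none = 0) := by
  induction X with
  | nil => rfl
  | cons t X ih =>
    have ih' := ih (fun t ht => h t (by simp [ht]))
    rcases h t (by simp) with rfl | rfl <;> simp [leads, ih']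

theorem flags_of_forall {m : ℕ} {X : List (Option ℕ)} (h : ∀ t ∈ X, t = none ∨ t = some m) :
    flags m X = flagBlock (X.count none) := by
  induction X with
  | nil => rfl
  | cons t X ih =>
    have h' : ∀ t ∈ X, t = none ∨ t = some m := fun t ht => h t (by simp [ht])
    rcases h t (by simp) with rfl | rfl
    · rw [flags, ih h', leads_of_forall h', List.count_cons_self]
      cases X.count none <;> simp [flagBlock, List.replicate_succ]
    · simp [flags, ih h']

theorem prune_forall {K : List ℕ → List ℕ → Prop} {m : ℕ} {pre post : List ℕ}
    {X : List (Option ℕ)} (h : ∀ t ∈ X, t = none ∨ t = some m) :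
    ∀ t ∈ prune K pre X post, t = none ∨ t = some m := by
  induction X generalizing pre with
  | nil => simp [prune]
  | cons t X ih =>
    have ih' := fun pre => ih (pre := pre) (fun t ht => h t (by simp [ht]))
    rcases h t (by simp) with rfl | rfl
    · rw [prune]
      split_ifs
      · exact ih' _
      · simpa using ih' _
    · simpa [prune] using ih' _

theorem block_forall (m x : ℕ) : ∀ t ∈ block m x, t = none ∨ t = some m := by
  induction x with
  | zero => simp [block]
  | succ x ih => simpa [block] using ih

theorem count_word_ins {m : ℕ} {Q : List (Option ℕ)} {y : List ℕ} (hQ : some m ∉ Q)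
    (hy : y.length = Q.count none) : (word (ins m Q y)).count m = y.sum := by
  induction Q generalizing y with
  | nil => simp_all [ins]
  | cons t Q ih =>
    cases t with
    | none =>
      cases y with
      | nil => simp at hy
      | cons x y =>
        have := ih (y := y) (by simp_all) (by simpa using hy)
        simp [ins, word_block, this]
    | some a =>
      simp only [List.mem_cons, Option.some.injEq, not_or] at hQ
      rw [ins, word_some, List.count_cons_of_ne (Ne.symm hQ.1), ih hQ.2 (by simpa using hy)]

theorem replicate_append_sublist {m o : ℕ} (ho : o ≠ m) (z x : ℕ) (l R : List ℕ) :
    (List.replicate z m ++ o :: l).Sublist (List.replicate x m ++ R) ↔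
      (List.replicate (z - x) m ++ o :: l).Sublist R := by
  induction x generalizing z with
  | zero => simp
  | succ x ih =>
    cases z with
    | zero =>
      have := ih 0
      simp only [List.replicate_zero, List.nil_append, Nat.zero_sub] at this ⊢
      rw [← this, List.replicate_succ, List.cons_append]
      constructor
      · intro h
        cases h with
        | cons _ h => exact h
        | cons_cons => exact absurd rfl ho
      · exact fun h => h.cons _
    | succ z =>
      simp only [List.replicate_succ, List.cons_append, List.cons_sublist_cons]
      rw [ih, Nat.add_sub_add_right]

theorem hasLow_replicate_append (m q z x : ℕ) (R : List ℕ) :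
    HasLow m q z (List.replicate x m ++ R) ↔ HasLow m q (z - x) R := by
  refine exists_congr fun o => and_congr_right fun ho => ?_
  exact replicate_append_sublist (by omega) _ _ _ _

theorem not_hasLow_replicate (m q z x : ℕ) : ¬ HasLow m q z (List.replicate x m) := by
  rintro ⟨o, ho, h⟩
  have := h.subset (a := o) (by simp)
  rw [List.mem_replicate] at this
  omega

theorem hasLow_cons {m q a : ℕ} (R : List ℕ) :
    HasLow m q 0 (a :: R) ↔ (a + 1 < m ∧ q ≤ R.count m) ∨ HasLow m q 0 R := by
  constructor
  · rintro ⟨o, ho, h⟩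
    cases h with
    | cons _ h => exact Or.inr ⟨o, ho, h⟩
    | cons_cons _ h => exact Or.inl ⟨ho, List.replicate_sublist_iff.mp h⟩
  · rintro (⟨h1, h2⟩ | ⟨o, ho, h⟩)
    · exact ⟨a, h1, (List.replicate_sublist_iff.mpr h2).cons_cons _⟩
    · exact ⟨o, ho, h.cons _⟩

theorem hasLow_cons_pos {m q a z : ℕ} (ha : a < m) (hz : 0 < z) (R : List ℕ) :
    HasLow m q z (a :: R) ↔ HasLow m q z R := by
  obtain ⟨z, rfl⟩ := Nat.exists_eq_succ_of_ne_zero hz.ne'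
  refine exists_congr fun o => and_congr_right fun ho => ?_
  rw [List.replicate_succ, List.cons_append]
  constructor
  · intro h
    cases h with
    | cons _ h => exact h
    | cons_cons => omega
  · exact fun h => h.cons _

theorem flags_ne_nil {m : ℕ} {Q : List (Option ℕ)} (hQ : Spaced Q) : flags m Q ≠ [] := by
  induction hQ with
  | gap => simp [flags]
  | letter _ _ ih => exact ih
  | gap_letter => simp [flags]

theorem isActive_of_ne_nil {q : ℕ} {b c x y} (hc : c ≠ []) :
    isActive q (b :: c) (x :: y) = ((b && decide (q ≤ y.sum)) || isActive q c y) := by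
  obtain ⟨b', c, rfl⟩ := List.exists_cons_of_ne_nil hc
  rfl

theorem hasLow_zero_iff {m q : ℕ} {Q : List (Option ℕ)} {y : List ℕ} (hQ : Spaced Q)
    (hm : ∀ a, some a ∈ Q → a < m) (hy : y.length = Q.count none) :
    HasLow m q 0 (word (ins m Q y)) ↔
      (leads (m - 1) Q = true ∧ q ≤ y.sum) ∨ isActive q (flags (m - 1) Q) y = true := by
  induction hQ generalizing y with
  | gap =>
    obtain ⟨x, rfl⟩ := List.length_eq_one_iff.mp (by simpa using hy)
    simp [ins, word_block, not_hasLow_replicate, leads, flags, isActive]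
  | @letter a Q hQ ih =>
    have ha : a < m := hm a (by simp)
    have hm' : ∀ a, some a ∈ Q → a < m := fun a h => hm a (by simp [h])
    have hy' : y.length = Q.count none := by simpa using hy
    rw [ins, word_some, hasLow_cons, ih hm' hy',
      count_word_ins (fun h => (hm' m h).false) hy']
    simp only [leads, flags, Bool.or_eq_true, bne_iff_ne]
    have : a + 1 < m ↔ a ≠ m - 1 := by omega
    tauto
  | @gap_letter a Q hQ ih =>
    cases y with
    | nil => simp at hy
    | cons x y =>
      have hy' : y.length = (some a :: Q).count none := by simpa using hy
      rw [ins, word_none, word_append, word_block, hasLow_replicate_append, Nat.zero_sub,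
        ih (fun a h => hm a (by simp [h])) hy', flags, isActive_of_ne_nil (flags_ne_nil hQ)]
      simp [leads]

theorem hasLow_iff {m q z : ℕ} {Q : List (Option ℕ)} {y : List ℕ} (hQ : Spaced Q)
    (hm : ∀ a, some a ∈ Q → a < m) (hy : y.length = Q.count none) :
    HasLow m q z (word (ins m Q y)) ↔
      HasLow m q 0 (word (ins m Q y)) ∧ z ≤ (activePart q (flags (m - 1) Q) y).sum := by
  induction hQ generalizing y z with
  | gap =>
    obtain ⟨x, rfl⟩ := List.length_eq_one_iff.mp (by simpa using hy)
    simp [ins, word_block, not_hasLow_replicate]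
  | @letter a Q hQ ih =>
    have ha : a < m := hm a (by simp)
    have hm' : ∀ a, some a ∈ Q → a < m := fun a h => hm a (by simp [h])
    have hy' : y.length = Q.count none := by simpa using hy
    rcases Nat.eq_zero_or_pos z with rfl | hz
    · simp
    · rw [ins, word_some, hasLow_cons_pos ha hz, ih hm' hy', hasLow_cons, flags]
      have : z ≤ (activePart q (flags (m - 1) Q) y).sum →
          HasLow m q 0 (word (ins m Q y)) := by
        intro h
        rw [hasLow_zero_iff hQ hm' hy', isActive_iff]
        right
        rintro h0
        simp [h0] at h
        omega
      tauto
  | @gap_letter a Q hQ ih =>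
    cases y with
    | nil => simp at hy
    | cons x y =>
      have hm' : ∀ b, some b ∈ some a :: Q → b < m := fun b h => hm b (by simp_all)
      have hy' : y.length = (some a :: Q).count none := by simpa using hy
      have h1 := hasLow_zero_iff (q := q) (.gap_letter a hQ) hm hy
      have h2 : leads (m - 1) (none :: some a :: Q) = false := rfl
      simp only [h2, Bool.false_eq_true, false_and, false_or] at h1
      rw [h1]
      rw [ins, word_none, word_append, word_block, hasLow_replicate_append, Nat.zero_sub] at h1
      rw [ins, word_none, word_append, word_block, hasLow_replicate_append, ih hm' hy', h1]
      refine and_congr_right fun h3 => ?_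
      rw [flags] at h3 ⊢
      rw [activePart, if_pos h3, List.sum_cons]
      omega

theorem count_prune_left (p q m x : ℕ) (pre R : List ℕ) :
    (prune (Kills p q false m) pre (none :: block m x) R).count none =
      open Classical in if HasLow m q 0 R then min (x + 1) (p - pre.count m) else x + 1 := by
  have h0 : ∀ x pre, Kills p q false m pre (word (block m x) ++ R) ↔
      p ≤ pre.count m ∧ HasLow m q 0 R := fun x pre => by
    simp [Kills, word_block, hasLow_replicate_append]
  induction x generalizing pre with
  | zero =>
    by_cases h : Kills p q false m pre (word (block m 0) ++ R)
    · rw [prune_none_pos h]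
      rw [h0] at h
      rw [if_pos h.2]
      simp [block, prune]
      omega
    · rw [prune_none_neg h]
      rw [h0] at h
      split_ifs with h'
      · simp [block, prune]
        grind
      · simp [block, prune]
  | succ x ih =>
    have ih' := ih (pre ++ [m])
    rw [block]
    by_cases h : Kills p q false m pre (word (block m (x + 1)) ++ R)
    · rw [← block, prune_none_pos h, block, prune]
      rw [h0] at h
      rw [if_pos h.2] at ih' ⊢
      rw [List.count_cons_of_ne (by simp), ih']
      simp
      omega
    · rw [← block, prune_none_neg h, block, prune, List.count_cons_self,
        List.count_cons_of_ne (by simp), ih']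
      rw [h0] at h
      split_ifs with h'
      · simp
        grind
      · rfl

theorem count_prune_right (p q m x A : ℕ) (pre R : List ℕ)
    (hR : ∀ z, HasLow m q z R ↔ HasLow m q 0 R ∧ z ≤ A) :
    (prune (Kills p q true m) pre (none :: block m x) R).count none =
      open Classical in if HasLow m q 0 R then min (x + 1) (p - A) else x + 1 := by
  have h0 : ∀ x pre, Kills p q true m pre (word (block m x) ++ R) ↔
      HasLow m q 0 R ∧ p - x ≤ A := fun x pre => by
    simp [Kills, word_block, hasLow_replicate_append, hR (p - x)]
  induction x generalizing pre with
  | zero =>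
    by_cases h : Kills p q true m pre (word (block m 0) ++ R)
    · rw [prune_none_pos h]
      rw [h0] at h
      rw [if_pos h.1]
      simp [block, prune]
      omega
    · rw [prune_none_neg h]
      rw [h0] at h
      split_ifs with h'
      · simp [block, prune]
        grind
      · simp [block, prune]
  | succ x ih =>
    have ih' := ih (pre ++ [m])
    rw [block]
    by_cases h : Kills p q true m pre (word (block m (x + 1)) ++ R)
    · rw [← block, prune_none_pos h, block, prune]
      rw [h0] at h
      rw [if_pos h.1] at ih' ⊢
      rw [List.count_cons_of_ne (by simp), ih']
      omega
    · rw [← block, prune_none_neg h, block, prune, List.count_cons_self,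
        List.count_cons_of_ne (by simp), ih']
      rw [h0] at h
      split_ifs with h'
      · grind
      · rfl

theorem flags_prune_ins {p q m : ℕ} {v : Bool} {Q : List (Option ℕ)} {y : List ℕ}
    (hQ : Spaced Q) (hm : ∀ a, some a ∈ Q → a < m) (hy : y.length = Q.count none)
    (pre : List ℕ) :
    flags m (prune (Kills p q v m) pre (ins m Q y) []) =
      render (if v then sizesRight p q (flags (m - 1) Q) y
        else sizesLeft p q (pre.count m) (flags (m - 1) Q) y) := by
  induction hQ generalizing y pre with
  | gap =>
    obtain ⟨x, rfl⟩ := List.length_eq_one_iff.mp (by simpa using hy)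
    have h : ¬ HasLow m q 0 [] := not_hasLow_replicate m q 0 0
    have h' : ∀ z, HasLow m q z [] ↔ HasLow m q 0 [] ∧ z ≤ 0 := fun z => by
      simp [show ¬ HasLow m q z [] from not_hasLow_replicate m q z 0, h]
    rw [ins, ins, List.append_nil, flags_of_forall]
    · cases v
      · simp [count_prune_left, h, flags, leads, sizesLeft, isActive, render]
      · simp [count_prune_right p q m x 0 pre [] h', h, flags, leads, sizesRight, isActive, render]
    · exact prune_forall (by simpa using block_forall m x)
  | @letter a Q hQ ih =>
    have ha : a < m := hm a (by simp)
    have hm' : ∀ a, some a ∈ Q → a < m := fun a h => hm a (by simp [h])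
    have hy' : y.length = Q.count none := by simpa using hy
    rw [ins, prune, flags, flags, ih hm' hy', List.count_append,
      List.count_eq_zero_of_not_mem (l := [a]) (by simpa using ha.ne'), Nat.add_zero]
  | @gap_letter a Q hQ ih =>
    cases y with
    | nil => simp at hy
    | cons x y =>
      have ha : a < m := hm a (by simp)
      have hm' : ∀ b, some b ∈ some a :: Q → b < m := fun b h => hm b (by simp_all)
      have hy' : y.length = (some a :: Q).count none := by simpa using hy
      have h1 := hasLow_zero_iff (q := q) (.gap_letter a hQ) hm hy
      have h2 : leads (m - 1) (none :: some a :: Q) = false := rfl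
      simp only [h2, Bool.false_eq_true, false_and, false_or] at h1
      rw [ins, word_none, word_append, word_block, hasLow_replicate_append, Nat.zero_sub] at h1
      have hR := fun z => hasLow_iff (q := q) (z := z) hQ hm' hy'
      have ih' := ih hm' hy' (pre ++ List.replicate x m)
      rw [ins, prune] at ih'
      rw [ins, ← List.cons_append, prune_append, List.append_nil, ins, prune,
        flags_append_some ha.ne, flags_of_forall (prune_forall (by simpa using block_forall m x)),
        word_none, word_block]
      rw [flags] at ih'
      rw [ih']
      cases v
      · simp only [Bool.false_eq_true, if_false]
        rw [flags, sizesLeft, render_cons, count_prune_left]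
        rw [ins] at h1
        classical rw [if_congr h1 rfl rfl]
        simp [flags]
        congr
      · rw [ins] at h1 hR
        simp only [if_true]
        rw [flags, sizesRight, render_cons, count_prune_right p q m x _ pre _ hR]
        classical rw [if_congr h1 rfl rfl]
        simp [flags]
        congr

/-- The parameters of a pair of patterns: `top` tells whether letters are inserted in
decreasing order of value, `rev` whether the region is read backwards. -/
structure Shape where
  /-- Letters of the word are distances from the maximum. -/
  top : Bool
  /-- The region is read from right to left. -/
  rev : Bool
  /-- The length of the run read first. -/
  p : ℕ
  /-- The length of the run read last. -/
  q : ℕ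

/-- The part of a word after the first occurrence of `r`. -/
def after (r : ℕ) (w : List ℕ) : List ℕ := (w.dropWhile (· ≠ r)).tail

/-- The letters less than `d`. -/
def below (d : ℕ) (w : List ℕ) : List ℕ := w.filter (· < d)

namespace Shape

variable (s : Shape)

/-- The letter whose first occurrence starts the region of level `k`. -/
def base (k : ℕ) : ℕ := if s.top then k - 1 else k

/-- A list or its reverse, depending on the direction in which the region is read. -/
def orient {α : Type} (l : List α) : List α := if s.rev then l.reverse else l

/-- `Kills`, with the gap given by the actual words on its left and right. -/
def KillsAt (v : Bool) (k : ℕ) (V₁ V₂ : List ℕ) : Prop :=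
  if s.rev then Kills s.p s.q v k V₂.reverse V₁.reverse else Kills s.p s.q v k V₁ V₂

/-- Inserting a letter greater than `k` between `V₁` and `V₂` creates a forbidden pattern
at level `k`. -/
def Bad (v : Bool) (k : ℕ) (V₁ V₂ : List ℕ) : Prop :=
  s.base k ∈ V₁ ∧ s.KillsAt v k (after (s.base k) V₁) V₂

/-- The letter `d` may be inserted between `V₁` and `V₂`. -/
def Allowed (v : Bool) (d : ℕ) (V₁ V₂ : List ℕ) : Prop :=
  (∀ k < d, ¬ s.Bad v k V₁ V₂) ∧ (s.top = false → d = 0 ∨ d - 1 ∈ V₁)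

/-- The letter `c` occurs in the word, and in the required place if `top` holds. -/
def Fits (c : ℕ) (V : List ℕ) : Prop :=
  if s.top then (below (c + 1) V).head? = some c else c ∈ V

/-- The words on the letters `0, …, d - 1` that encode avoiders. -/
def Node (v : Bool) (d : ℕ) (V : List ℕ) : Prop :=
  (∀ a ∈ V, a < d) ∧
    ∀ c < d, s.Fits c V ∧ ∀ V₁ V₂, V = V₁ ++ c :: V₂ → s.Allowed v c V₁ V₂

end Shape

theorem mem_below {a d : ℕ} {w : List ℕ} : a ∈ below d w ↔ a ∈ w ∧ a < d := by simp [below]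

@[simp] theorem below_nil (d : ℕ) : below d [] = [] := rfl

@[simp] theorem below_append (d : ℕ) (w w' : List ℕ) :
    below d (w ++ w') = below d w ++ below d w' := by simp [below]

theorem below_cons_of_lt {a d : ℕ} (h : a < d) (w : List ℕ) :
    below d (a :: w) = a :: below d w := by simp [below, h]

theorem below_cons_of_le {a d : ℕ} (h : d ≤ a) (w : List ℕ) :
    below d (a :: w) = below d w := by simp [below, h]

theorem below_reverse (d : ℕ) (w : List ℕ) : below d w.reverse = (below d w).reverse := by
  simp [below]

theorem below_eq_self {d : ℕ} {w : List ℕ} (h : ∀ a ∈ w, a < d) : below d w = w := by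
  simpa [below] using h

theorem below_below {c d : ℕ} (h : c ≤ d) (w : List ℕ) : below c (below d w) = below c w := by
  simp only [below, List.filter_filter]
  exact List.filter_congr fun a _ => by simp; omega

theorem after_append_of_notMem {r : ℕ} {w : List ℕ} (h : r ∉ w) (w' : List ℕ) :
    after r (w ++ r :: w') = w' := by
  rw [after, List.dropWhile_append_of_pos]
  · simp
  · intro a ha
    have : a ≠ r := fun h' => h (h' ▸ ha)
    simpa using this

theorem after_append_of_mem {r : ℕ} {w : List ℕ} (h : r ∈ w) (w' : List ℕ) :
    after r (w ++ w') = after r w ++ w' := by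
  obtain ⟨w₁, w₂, rfl, h'⟩ := List.eq_append_cons_of_mem h
  rw [List.append_assoc, List.cons_append, after_append_of_notMem h', after_append_of_notMem h']

theorem after_below {r d : ℕ} (h : r < d) (w : List ℕ) :
    after r (below d w) = below d (after r w) := by
  by_cases hr : r ∈ w
  · obtain ⟨w₁, w₂, rfl, h'⟩ := List.eq_append_cons_of_mem hr
    rw [below_append, below_cons_of_lt h, after_append_of_notMem, after_append_of_notMem h']
    simp [mem_below, h']
  · have h1 : ∀ w, r ∉ w → after r w = [] := by
      intro w hw
      rw [after, List.dropWhile_eq_nil_iff.mpr]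
      · rfl
      · intro a ha
        have : a ≠ r := fun h' => hw (h' ▸ ha)
        simpa using this
    rw [h1 _ hr, h1 _ (by simp [mem_below, hr])]
    rfl

theorem sublist_below {d : ℕ} {l w : List ℕ} (h : ∀ a ∈ l, a < d) :
    l.Sublist (below d w) ↔ l.Sublist w := by
  refine ⟨fun h' => h'.trans List.filter_sublist, fun h' => ?_⟩
  rw [← below_eq_self h]
  exact h'.filter _

theorem hasLow_below {m q z d : ℕ} (h : m < d) (w : List ℕ) :
    HasLow m q z (below d w) ↔ HasLow m q z w := by
  refine exists_congr fun o => and_congr_right fun ho => sublist_below ?_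
  simp only [List.mem_append, List.mem_replicate, List.mem_cons]
  omega

theorem kills_below {p q k d : ℕ} {v : Bool} (h : k < d) (V₁ V₂ : List ℕ) :
    Kills p q v k (below d V₁) (below d V₂) ↔ Kills p q v k V₁ V₂ := by
  have : (below d V₁).count k = V₁.count k := List.count_filter (by simpa using h)
  simp only [Kills, hasLow_below h, this]

/-- Mark the gaps of the word at which the predicate holds. -/
noncomputable def marks (P : List ℕ → List ℕ → Prop) : List ℕ → List ℕ → List (Option ℕ)
  | V, [] => open Classical in if P V [] then [none] else []
  | V, a :: W => open Classical in
    if P V (a :: W) then none :: some a :: marks P (V ++ [a]) W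
    else some a :: marks P (V ++ [a]) W

namespace Shape

variable (s : Shape)

theorem bad_below {v : Bool} {k d : ℕ} (h : k < d) (V₁ V₂ : List ℕ) :
    s.Bad v k (below d V₁) (below d V₂) ↔ s.Bad v k V₁ V₂ := by
  have h' : s.base k < d := by rw [base]; split_ifs <;> omega
  simp only [Bad, KillsAt, mem_below, h', and_true, after_below h', ← below_reverse,
    kills_below h]

theorem allowed_below {v : Bool} {c d : ℕ} (h : c ≤ d) (V₁ V₂ : List ℕ) :
    s.Allowed v c (below d V₁) (below d V₂) ↔ s.Allowed v c V₁ V₂ := by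
  have h1 : ∀ k < c, (s.Bad v k (below d V₁) (below d V₂) ↔ s.Bad v k V₁ V₂) :=
    fun k hk => s.bad_below (by omega) _ _
  have h2 : c = 0 ∨ c - 1 ∈ below d V₁ ↔ c = 0 ∨ c - 1 ∈ V₁ := by
    rw [mem_below]
    constructor
    · tauto
    · rintro (h' | h')
      · exact Or.inl h'
      · by_cases h0 : c = 0
        · exact Or.inl h0
        · exact Or.inr ⟨h', by omega⟩
  rw [Allowed, Allowed, h2]
  exact and_congr (forall₂_congr fun k hk => not_congr (h1 k hk)) Iff.rfl

theorem fits_below {c d : ℕ} (h : c < d) (V : List ℕ) : s.Fits c (below d V) ↔ s.Fits c V := by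
  simp only [Fits, below_below (show c + 1 ≤ d from h), mem_below, h, and_true]

theorem node_succ {v : Bool} {d : ℕ} {V : List ℕ} :
    s.Node v (d + 1) V ↔ s.Node v d (below d V) ∧ (∀ a ∈ V, a ≤ d) ∧ s.Fits d V ∧
      ∀ V₁ V₂, V = V₁ ++ d :: V₂ → s.Allowed v d V₁ V₂ := by
  have key : ∀ c < d, ((∀ V₁ V₂, V = V₁ ++ c :: V₂ → s.Allowed v c V₁ V₂) ↔
      ∀ V₁ V₂, below d V = V₁ ++ c :: V₂ → s.Allowed v c V₁ V₂) := by
    intro c hc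
    constructor
    · intro h V₁ V₂ h'
      rw [below, List.filter_eq_append_iff] at h'
      obtain ⟨A, B, rfl, rfl, h'⟩ := h'
      rw [List.filter_eq_cons_iff] at h'
      obtain ⟨A', B', rfl, hA', -, rfl⟩ := h'
      have h1 := h (A ++ A') B' (by simp)
      rw [← s.allowed_below hc.le, below_append] at h1
      have h2 : below d A' = [] := by simpa [below] using hA'
      rwa [h2, List.append_nil] at h1
    · rintro h V₁ V₂ rfl
      rw [← s.allowed_below hc.le]
      exact h _ _ (by rw [below_append, below_cons_of_lt hc])
  constructor
  · rintro ⟨h1, h2⟩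
    refine ⟨⟨fun a ha => (mem_below.mp ha).2, fun c hc => ?_⟩,
      fun a ha => Nat.lt_succ_iff.mp (h1 a ha), h2 d (by omega)⟩
    rw [s.fits_below hc, ← key c hc]
    exact h2 c (by omega)
  · rintro ⟨h1, h2, h3⟩
    refine ⟨fun a ha => Nat.lt_succ_iff.mpr (h2 a ha), fun c hc => ?_⟩
    rcases Nat.lt_succ_iff_lt_or_eq.mp hc with hc | rfl
    · rw [← s.fits_below hc, key c hc]
      exact h1.2 c hc
    · exact h3

end Shape

theorem word_marks (P : List ℕ → List ℕ → Prop) (V W : List ℕ) : word (marks P V W) = W := by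
  induction W generalizing V with
  | nil => rw [marks]; split_ifs <;> rfl
  | cons a W ih => rw [marks]; split_ifs <;> simp [ih]

theorem marks_of_pos {P : List ℕ → List ℕ → Prop} {V W : List ℕ} (h : P V W) :
    ∃ R, marks P V W = none :: R := by
  cases W with
  | nil => exact ⟨_, by rw [marks, if_pos h]⟩
  | cons a W => exact ⟨_, by rw [marks, if_pos h]⟩

theorem marks_cons_pos {P : List ℕ → List ℕ → Prop} {V W : List ℕ} {a : ℕ} (h : P V (a :: W)) :
    marks P V (a :: W) = none :: some a :: marks P (V ++ [a]) W := by
  rw [marks, if_pos h]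

theorem marks_cons_neg {P : List ℕ → List ℕ → Prop} {V W : List ℕ} {a : ℕ} (h : ¬ P V (a :: W)) :
    marks P V (a :: W) = some a :: marks P (V ++ [a]) W := by
  rw [marks, if_neg h]

/-- A word with letters `d` only at gaps satisfying the predicate arises by inserting them. -/
theorem exists_marks_eq_ins {d : ℕ} {P : List ℕ → List ℕ → Prop}
    (hP : ∀ V W, P (below d V) (below d W) ↔ P V W) {V W : List ℕ} (hW : ∀ a ∈ W, a ≤ d)
    (h : ∀ A B, W = A ++ d :: B → P (V ++ A) B) :
    ∃ x : List ℕ, x.length = (marks P (below d V) (below d W)).count none ∧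
      marks P V W = ins d (marks P (below d V) (below d W)) x := by
  induction W generalizing V with
  | nil =>
    have := hP V []
    rw [below_nil] at this ⊢
    by_cases h0 : P V []
    · refine ⟨[0], ?_⟩
      rw [marks, marks, if_pos h0, if_pos (this.mpr h0)]
      simp [ins, block]
    · refine ⟨[], ?_⟩
      rw [marks, marks, if_neg h0, if_neg (mt this.mp h0)]
      simp [ins]
  | cons a W ih =>
    obtain ⟨x, hx, hx'⟩ := ih (V := V ++ [a]) (fun b hb => hW b (by simp [hb]))
      (fun A B hAB => by simpa using h (a :: A) B (by simp [hAB]))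
    have hPa := hP V (a :: W)
    rcases (hW a (by simp)).lt_or_eq with ha | rfl
    · rw [below_append, below_cons_of_lt ha, below_nil] at hx hx'
      rw [below_cons_of_lt ha] at hPa ⊢
      by_cases h0 : P V (a :: W)
      · refine ⟨0 :: x, ?_⟩
        rw [marks_cons_pos h0, marks_cons_pos (hPa.mpr h0), hx']
        simp [ins, block, hx]
      · refine ⟨x, ?_⟩
        rw [marks_cons_neg h0, marks_cons_neg (mt hPa.mp h0), hx']
        simp [ins, hx]
    · have h1 : P V W := by simpa using h [] W rfl
      rw [below_append, below_cons_of_le le_rfl, below_nil, List.append_nil] at hx hx'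
      rw [below_cons_of_le le_rfl] at hPa ⊢
      have h2 := (hP V W).mpr h1
      obtain ⟨R, hR⟩ := marks_of_pos h2
      rw [hR] at hx hx' ⊢
      rw [marks_cons_pos (hPa.mp h2), hx']
      cases x with
      | nil => simp at hx
      | cons x₀ x => exact ⟨(x₀ + 1) :: x, by simpa using hx, by simp [ins, block]⟩

/-- The marked word `T` is `W` with letters `d` inserted at gaps of `W` after `V`. -/
def IsInsertion (d : ℕ) (P : List ℕ → List ℕ → Prop) (V W : List ℕ) (T : List (Option ℕ)) : Prop :=
  below d (word T) = W ∧ marks P V (word T) = T ∧ (∀ a ∈ word T, a ≤ d) ∧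
    ∀ A B, word T = A ++ d :: B → P (V ++ A) B

theorem IsInsertion.block {d : ℕ} {P : List ℕ → List ℕ → Prop}
    (hP : ∀ V W, P (below d V) (below d W) ↔ P V W) {V₀ W : List ℕ} {R : List (Option ℕ)}
    (h₀ : P V₀ W) (h : ∀ V, below d V = V₀ → IsInsertion d P V W (none :: R)) (x : ℕ) :
    ∀ V, below d V = V₀ → IsInsertion d P V W (none :: (block d x ++ R)) := by
  induction x with
  | zero => exact h
  | succ x ih =>
    intro V hV
    obtain ⟨h1, h2, h3, h4⟩ := ih (V ++ [d]) (by simpa [below_cons_of_le] using hV)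
    rw [word_none] at h1 h2 h3 h4
    simp only [_root_.block, List.cons_append]
    refine ⟨?_, ?_, ?_, ?_⟩
    · simpa [below_cons_of_le] using h1
    · rw [word_none, word_some, word_none, marks_cons_pos, h2]
      rw [← hP, hV, below_cons_of_le le_rfl, h1]
      exact h₀
    · simpa using h3
    · rintro A B hAB
      cases A with
      | nil =>
        obtain rfl : word (_root_.block d x ++ R) = B := by simpa using hAB
        rw [List.append_nil, ← hP, hV, h1]
        exact h₀
      | cons a A =>
        simp only [word_none, word_some, List.cons_append, List.cons.injEq] at hAB
        simpa [hAB.1] using h4 A B hAB.2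

theorem IsInsertion.letter {d a : ℕ} {P : List ℕ → List ℕ → Prop} (ha : a < d)
    {V W : List ℕ} {T : List (Option ℕ)} (h : IsInsertion d P (V ++ [a]) W T) :
    IsInsertion d P V (a :: W) (open Classical in if P V (a :: word T) then none :: some a :: T
      else some a :: T) := by
  obtain ⟨h1, h2, h3, h4⟩ := h
  have h5 : word (open Classical in if P V (a :: word T) then none :: some a :: T
      else some a :: T) = a :: word T := by split_ifs <;> rfl
  rw [IsInsertion, h5]
  refine ⟨by rw [below_cons_of_lt ha, h1], by rw [marks, h2], by simpa [ha.le] using h3, ?_⟩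
  rintro A B hAB
  cases A with
  | nil =>
    simp only [List.nil_append, List.cons.injEq] at hAB
    omega
  | cons b A =>
    simp only [List.cons_append, List.cons.injEq] at hAB
    simpa [hAB.1] using h4 A B hAB.2

/-- Inserting letters `d` at the marked gaps yields a word whose marks are as expected. -/
theorem isInsertion_ins {d : ℕ} {P : List ℕ → List ℕ → Prop}
    (hP : ∀ V W, P (below d V) (below d W) ↔ P V W) {W : List ℕ} (hW : ∀ a ∈ W, a < d)
    {x V₀ : List ℕ} (hx : x.length = (marks P V₀ W).count none) {V : List ℕ}
    (hV : below d V = V₀) : IsInsertion d P V W (ins d (marks P V₀ W) x) := by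
  induction W generalizing V V₀ x with
  | nil =>
    by_cases h : P V₀ []
    · rw [marks, if_pos h] at hx ⊢
      obtain ⟨x₀, rfl⟩ := List.length_eq_one_iff.mp (by simpa using hx)
      rw [ins, ins]
      refine IsInsertion.block hP h (fun V hV => ?_) x₀ V hV
      refine ⟨rfl, ?_, by simp, by simp⟩
      rw [word_none, word_nil, marks, if_pos]
      rwa [← hP, hV]
    · rw [marks, if_neg h] at hx ⊢
      rw [ins]
      refine ⟨rfl, ?_, by simp, by simp⟩
      rw [word_nil, marks, if_neg]
      rwa [← hP, hV]
  | cons a W ih =>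
    have ha : a < d := hW a (by simp)
    have ih' : ∀ {x}, x.length = (marks P (V₀ ++ [a]) W).count none → ∀ {V}, below d V = V₀ →
        IsInsertion d P (V ++ [a]) W (ins d (marks P (V₀ ++ [a]) W) x) := fun hx V hV =>
      ih (fun b hb => hW b (by simp [hb])) hx (by simp [below_cons_of_lt ha, hV])
    have hPa : ∀ {x}, x.length = (marks P (V₀ ++ [a]) W).count none → ∀ {V}, below d V = V₀ →
        (P V (a :: word (ins d (marks P (V₀ ++ [a]) W) x)) ↔ P V₀ (a :: W)) := fun hx V hV => by
      rw [← hP, hV, below_cons_of_lt ha, (ih' hx hV).1]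
    by_cases h : P V₀ (a :: W)
    · rw [marks_cons_pos h] at hx ⊢
      cases x with
      | nil => simp at hx
      | cons x₀ x =>
        have hx' : x.length = (marks P (V₀ ++ [a]) W).count none := by simpa using hx
        rw [ins, ins]
        refine IsInsertion.block hP h (fun V hV => ?_) x₀ V hV
        have := (ih' hx' hV).letter ha
        rwa [if_pos ((hPa hx' hV).mpr h)] at this
    · rw [marks_cons_neg h] at hx ⊢
      have hx' : x.length = (marks P (V₀ ++ [a]) W).count none := by simpa using hx
      rw [ins]
      have := (ih' hx' hV).letter ha
      rwa [if_neg (mt (hPa hx' hV).mp h)] at this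

theorem block_append_inj {m x x' : ℕ} {R R' : List (Option ℕ)}
    (hR : ∀ T, R ≠ some m :: T) (hR' : ∀ T, R' ≠ some m :: T)
    (h : block m x ++ R = block m x' ++ R') : x = x' ∧ R = R' := by
  induction x generalizing x' with
  | zero =>
    cases x' with
    | zero => exact ⟨rfl, h⟩
    | succ x' => exact absurd h (hR _)
  | succ x ih =>
    cases x' with
    | zero => exact absurd h.symm (hR' _)
    | succ x' =>
      simp only [block, List.cons_append, List.cons.injEq, true_and] at h
      simpa using ih h

theorem ins_inj {m : ℕ} {D : List (Option ℕ)} (hD : some m ∉ D) {x x' : List ℕ}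
    (hx : x.length = D.count none) (hx' : x'.length = D.count none)
    (h : ins m D x = ins m D x') : x = x' := by
  have hne : ∀ {D : List (Option ℕ)} (y : List ℕ), some m ∉ D → ∀ T, ins m D y ≠ some m :: T := by
    rintro D y hD T h
    match D, y, h, hD with
    | some a :: D, y, h, hD =>
      simp only [ins, List.cons.injEq, Option.some.injEq] at h
      simp [h.1] at hD
    | none :: D, [], h, hD => simp [ins] at h
    | none :: D, x :: y, h, hD => simp [ins] at h
    | [], y, h, hD => simp [ins] at h
  induction D generalizing x x' with
  | nil => simp_all
  | cons t D ih =>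
    have hD' : some m ∉ D := fun h' => hD (by simp [h'])
    cases t with
    | some a =>
      simp only [ins, List.cons.injEq, true_and] at h
      exact ih hD' (by simpa using hx) (by simpa using hx') h
    | none =>
      cases x with
      | nil => simp at hx
      | cons x₀ x =>
        cases x' with
        | nil => simp at hx'
        | cons x₀' x' =>
          simp only [ins, List.cons.injEq, true_and] at h
          obtain ⟨rfl, h0⟩ := block_append_inj (hne _ hD') (hne _ hD') h
          rw [ih hD' (by simpa using hx) (by simpa using hx') h0]

theorem length_word_ins {m : ℕ} {D : List (Option ℕ)} {x : List ℕ}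
    (hx : x.length = D.count none) :
    (word (ins m D x)).length = (word D).length + x.sum := by
  induction D generalizing x with
  | nil => simp_all [ins]
  | cons t D ih =>
    cases t with
    | some a =>
      rw [ins, word_some, word_some, List.length_cons, List.length_cons, ih (by simpa using hx)]
      omega
    | none =>
      cases x with
      | nil => simp at hx
      | cons x₀ x =>
        rw [ins, word_none, word_append, word_block, List.length_append, ih (by simpa using hx)]
        simp
        omega

theorem spaced_of_isChain {T : List (Option ℕ)}
    (h : T.IsChain fun s t => ¬ (s = none ∧ t = none)) (hT : T.getLast? = some none) :
    Spaced T := by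
  induction T with
  | nil => simp at hT
  | cons t T ih =>
    cases T with
    | nil =>
      obtain rfl : t = none := by simpa using hT
      exact .gap
    | cons t' T =>
      rw [List.isChain_cons_cons] at h
      rw [List.getLast?_cons_cons] at hT
      have ih' := ih h.2 hT
      cases t with
      | some a => exact .letter a ih'
      | none =>
        cases t' with
        | none => exact absurd ⟨rfl, rfl⟩ h.1
        | some b => exact .gap_letter b ih'

theorem Spaced.of_append {X Y : List (Option ℕ)} (h : Spaced (X ++ none :: Y)) :
    Spaced (none :: Y) := by
  induction X with
  | nil => exact h
  | cons t X ih =>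
    rw [List.cons_append] at h
    generalize hZ : X ++ none :: Y = Z at h ih
    cases h with
    | gap => simp at hZ
    | letter a h => exact ih h
    | gap_letter a h => exact ih h

theorem Spaced.append_left {X Y : List (Option ℕ)} (h : Spaced (X ++ none :: Y)) :
    Spaced (X ++ [none]) := by
  induction X with
  | nil => exact .gap
  | cons t X ih =>
    rw [List.cons_append] at h ⊢
    generalize hZ : X ++ none :: Y = Z at h ih
    cases h with
    | gap => simp at hZ
    | letter a h => exact .letter a (ih h)
    | gap_letter a h =>
      have ih' := ih h
      cases X with
      | nil => simp at hZ
      | cons t' X =>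
        simp only [List.cons_append, List.cons.injEq] at hZ
        rw [hZ.1, List.cons_append] at ih' ⊢
        exact .gap_letter a ih'

theorem flags_append_drop (m : ℕ) (X Y : List (Option ℕ)) :
    (flags m (X ++ Y)).drop (X.count none) = flags m Y := by
  induction X with
  | nil => rfl
  | cons t X ih => cases t <;> simp [flags, ih]

theorem flags_append_take (m : ℕ) (X Y : List (Option ℕ)) :
    (flags m (X ++ none :: Y)).take (X.count none) ++ [true] = flags m (X ++ [none]) := by
  induction X with
  | nil => rfl
  | cons t X ih =>
    cases t with
    | none =>
      simp only [List.cons_append, flags, List.count_cons_self, List.take_succ_cons, ih,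
        leads_append_of_gap m X Y]
    | some a => simpa [flags] using ih

theorem marks_isChain (P : List ℕ → List ℕ → Prop) (V W : List ℕ) :
    (marks P V W).IsChain fun s t => ¬ (s = none ∧ t = none) := by
  induction W generalizing V with
  | nil => rw [marks]; split_ifs <;> simp
  | cons a W ih => rw [marks]; split_ifs <;> simpa [List.isChain_cons] using ih _

theorem marks_getLast? {P : List ℕ → List ℕ → Prop} {V W : List ℕ} (h : P (V ++ W) []) :
    (marks P V W).getLast? = some none := by
  induction W generalizing V with
  | nil => rw [marks, if_pos (by simpa using h)]; rfl
  | cons a W ih =>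
    have ih' := ih (V := V ++ [a]) (by simpa using h)
    rw [marks]
    split_ifs <;> simp [List.getLast?_cons, ih']

theorem marks_of_neg {P : List ℕ → List ℕ → Prop} {V B A : List ℕ} {n : ℕ}
    (h : ∀ B₁ B₂, B = B₁ ++ B₂ → ¬ P (V ++ B₁) (B₂ ++ n :: A)) :
    marks P V (B ++ n :: A) = B.map some ++ some n :: marks P (V ++ B ++ [n]) A := by
  induction B generalizing V with
  | nil =>
    rw [List.nil_append, marks_cons_neg (by simpa using h [] [] rfl)]
    simp
  | cons b B ih =>
    rw [List.cons_append, marks_cons_neg (by simpa using h [] (b :: B) rfl),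
      ih fun B₁ B₂ hB => by simpa using h (b :: B₁) B₂ (by simp [hB])]
    simp

theorem marks_suffix {P : List ℕ → List ℕ → Prop} {V W : List ℕ} {T₁ T₂ : List (Option ℕ)}
    (h : marks P V W = T₁ ++ none :: T₂) : marks P (V ++ word T₁) (word T₂) = none :: T₂ := by
  induction W generalizing V T₁ with
  | nil =>
    rw [marks] at h
    split_ifs at h with h0
    · cases T₁ with
      | nil =>
        obtain rfl : T₂ = [] := by simpa using h
        simp [marks, h0]
      | cons t T₁ => simp at h
    · simp at h
  | cons a W ih =>
    cases T₁ with
    | nil =>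
      have := word_marks P V (a :: W)
      rw [h] at this
      rw [List.nil_append, word_none] at this
      rw [this, word_nil, List.append_nil, h, List.nil_append]
    | cons t T₁ =>
      rw [marks] at h
      split_ifs at h with h0
      · cases T₁ with
        | nil => simp at h
        | cons t' T₁ =>
          simp only [List.cons_append, List.cons.injEq] at h
          obtain ⟨rfl, rfl, h⟩ := h
          simpa using ih h
      · simp only [List.cons_append, List.cons.injEq] at h
        obtain ⟨rfl, h⟩ := h
        simpa using ih h

theorem marks_eq_prune {P P' K : List ℕ → List ℕ → Prop} {V₁ V₂ : List ℕ}
    (h : ∀ A B, V₂ = A ++ B → (P' (V₁ ++ A) B ↔ P (V₁ ++ A) B ∧ ¬ K (V₁ ++ A) B)) :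
    marks P' V₁ V₂ = prune K V₁ (marks P V₁ V₂) [] := by
  induction V₂ generalizing V₁ with
  | nil =>
    have := h [] [] rfl
    rw [List.append_nil] at this
    by_cases h1 : P V₁ []
    · by_cases h2 : K V₁ []
      · rw [marks, marks, if_pos h1, prune_none_pos h2, if_neg (by tauto), prune]
      · rw [marks, marks, if_pos h1, prune_none_neg h2, if_pos (by tauto), prune]
    · rw [marks, marks, if_neg h1, if_neg (by tauto), prune]
  | cons a V₂ ih =>
    have h0 := h [] (a :: V₂) rfl
    rw [List.append_nil] at h0
    have ih' := ih (V₁ := V₁ ++ [a]) fun A B hAB => by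
      simpa using h (a :: A) B (by simp [hAB])
    have h3 : word (some a :: marks P (V₁ ++ [a]) V₂) ++ [] = a :: V₂ := by
      simp [word_marks]
    by_cases h1 : P V₁ (a :: V₂)
    · by_cases h2 : K V₁ (a :: V₂)
      · rw [marks_cons_pos h1, prune_none_pos (by rwa [h3]), marks_cons_neg (by tauto), prune, ih']
      · rw [marks_cons_pos h1, prune_none_neg (by rwa [h3]), marks_cons_pos (by tauto), prune, ih']
    · rw [marks_cons_neg h1, marks_cons_neg (by tauto), prune, ih']

theorem prune_congr {K K' : List ℕ → List ℕ → Prop} {U U' : List ℕ} {X : List (Option ℕ)}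
    {post : List ℕ} (h : ∀ A B, K (U ++ A) B ↔ K' (U' ++ A) B) :
    prune K U X post = prune K' U' X post := by
  induction X generalizing U U' with
  | nil => rfl
  | cons t X ih =>
    cases t with
    | some a =>
      rw [prune, prune, ih (U := U ++ [a]) (U' := U' ++ [a]) fun A B => by simpa using h (a :: A) B]
    | none =>
      have h0 := h [] (word X ++ post)
      rw [List.append_nil, List.append_nil] at h0
      by_cases h1 : K U (word X ++ post)
      · rw [prune_none_pos h1, prune_none_pos (h0.mp h1), ih h]
      · rw [prune_none_neg h1, prune_none_neg (mt h0.mpr h1), ih h]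

theorem prune_eq_self {K : List ℕ → List ℕ → Prop} {pre : List ℕ} {X : List (Option ℕ)}
    {post : List ℕ} (h : ∀ A B, A <+: word X → ¬ K (pre ++ A) B) : prune K pre X post = X := by
  induction X generalizing pre with
  | nil => rfl
  | cons t X ih =>
    cases t with
    | some a =>
      rw [prune, ih fun A B hA => by simpa using h (a :: A) B (by simpa using hA)]
    | none => rw [prune_none_neg (by simpa using h [] _ (by simp)), ih h]

theorem word_reverse (X : List (Option ℕ)) : word X.reverse = (word X).reverse := by
  induction X with
  | nil => rfl
  | cons t X ih => cases t <;> simp [ih]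

theorem prune_reverse (K : List ℕ → List ℕ → Prop) (pre post : List ℕ) (X : List (Option ℕ)) :
    (prune K pre X post).reverse =
      prune (fun a b => K b.reverse a.reverse) post.reverse X.reverse pre.reverse := by
  induction X generalizing pre with
  | nil => rfl
  | cons t X ih =>
    rw [List.reverse_cons, prune_append, word_reverse]
    cases t with
    | some a =>
      rw [prune, List.reverse_cons, ih]
      simp [prune]
    | none =>
      have h0 : K pre (word X ++ post) ↔ K (word ([] : List (Option ℕ)) ++ pre.reverse).reverse
        (post.reverse ++ (word X).reverse).reverse := by simp
      by_cases h : K pre (word X ++ post)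
      · rw [prune_none_pos h, prune_none_pos (h0.mp h), ih]
        simp [prune]
      · rw [prune_none_neg h, prune_none_neg (mt h0.mpr h), List.reverse_cons, ih]
        simp [prune]

theorem ins_append {m : ℕ} {D E : List (Option ℕ)} {x y : List ℕ} (hx : x.length = D.count none) :
    ins m (D ++ E) (x ++ y) = ins m D x ++ ins m E y := by
  induction D generalizing x with
  | nil => simp_all [ins]
  | cons t D ih =>
    cases t with
    | some a => simp [ins, ih (by simpa using hx)]
    | none =>
      cases x with
      | nil => simp at hx
      | cons x₀ x => simp [ins, ih (show x.length = D.count none by simpa using hx)]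

theorem ins_replicate_zero (m : ℕ) (D : List (Option ℕ)) :
    ins m D (List.replicate (D.count none) 0) = D := by
  induction D with
  | nil => rfl
  | cons t D ih => cases t <;> simp [ins, block, ih, List.replicate_succ]

theorem none_block_reverse (m x : ℕ) : (none :: block m x).reverse = none :: block m x := by
  induction x with
  | zero => rfl
  | succ x ih =>
    have h : ∀ x, block m x ++ [some m, none] = some m :: none :: block m x := by
      intro x
      induction x with
      | zero => rfl
      | succ x ih => simp [block, ih]
    simp only [List.reverse_cons, block] at ih ⊢
    rw [ih]
    simp [h]

theorem ins_reverse {m : ℕ} {D : List (Option ℕ)} {x : List ℕ} (hx : x.length = D.count none) :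
    (ins m D x).reverse = ins m D.reverse x.reverse := by
  induction D generalizing x with
  | nil => simp_all [ins]
  | cons t D ih =>
    cases t with
    | some a =>
      have := ins_append (m := m) (D := D.reverse) (E := [some a]) (x := x.reverse) (y := [])
        (by simpa using hx)
      rw [List.append_nil] at this
      rw [List.reverse_cons, this, ins, List.reverse_cons, ih (by simpa using hx)]
      simp [ins]
    | none =>
      cases x with
      | nil => simp at hx
      | cons x₀ x =>
        have hx' : x.length = D.count none := by simpa using hx
        rw [List.reverse_cons, List.reverse_cons, ins_append (by simpa using hx'), ins,
          ← List.cons_append, List.reverse_append, none_block_reverse, ih hx']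
        simp [ins]

namespace Shape

variable (s : Shape)

/-- The marked part of the word after the first occurrence of `n`. -/
noncomputable def region (v : Bool) (n : ℕ) (W : List ℕ) : List (Option ℕ) :=
  marks (s.Allowed v (n + 1)) (W.takeWhile (· ≠ n) ++ [n]) (after n W)

/-- The flags of the available gaps of a node with letters `0, …, n`. -/
noncomputable def state (v : Bool) (n : ℕ) (W : List ℕ) : List Bool :=
  flags n (s.orient (s.region v n W))

variable {s}

theorem region_eq {v : Bool} {n : ℕ} {B A : List ℕ} (h : n ∉ B) :
    s.region v n (B ++ n :: A) = marks (s.Allowed v (n + 1)) (B ++ [n]) A := by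
  rw [region, after_append_of_notMem h, List.takeWhile_append_of_pos]
  · simp
  · intro a ha
    have : a ≠ n := fun h' => h (h' ▸ ha)
    simpa using this

theorem Node.exists_eq {v : Bool} {n : ℕ} {W : List ℕ} (h : s.Node v (n + 1) W) :
    ∃ B A, W = B ++ n :: A ∧ n ∉ B ∧ (s.top = true → B = []) := by
  have h0 := (h.2 n (by omega)).1
  rw [Fits] at h0
  split_ifs at h0 with ht
  · rw [below_eq_self h.1, List.head?_eq_some_iff] at h0
    obtain ⟨A, rfl⟩ := h0
    exact ⟨[], A, rfl, by simp, fun _ => rfl⟩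
  · obtain ⟨B, A, rfl, h'⟩ := List.eq_append_cons_of_mem h0
    exact ⟨B, A, rfl, h', fun h => absurd h ht⟩

variable (s)

theorem mem_orient {α : Type} {a : α} {l : List α} : a ∈ s.orient l ↔ a ∈ l := by
  rw [orient]; split_ifs <;> simp

theorem orient_orient {α : Type} (l : List α) : s.orient (s.orient l) = l := by
  rw [orient, orient]; split_ifs <;> simp

theorem length_orient {α : Type} (l : List α) : (s.orient l).length = l.length := by
  rw [orient]; split_ifs <;> simp

theorem sum_orient (l : List ℕ) : (s.orient l).sum = l.sum := by
  rw [orient]; split_ifs <;> simp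

theorem count_orient (l : List (Option ℕ)) : (s.orient l).count none = l.count none := by
  rw [orient]; split_ifs <;> simp

theorem length_state (v : Bool) (n : ℕ) (W : List ℕ) :
    (s.state v n W).length = (s.region v n W).count none := by
  rw [state, length_flags, count_orient]

variable {s}

theorem not_killsAt {v : Bool} {k : ℕ} {V₁ V₂ : List ℕ}
    (h : if s.rev then V₁ = [] else V₂ = []) : ¬ s.KillsAt v k V₁ V₂ := by
  have h0 : ∀ q z, ¬ HasLow k q z [] := fun q z => not_hasLow_replicate k q z 0
  rw [KillsAt]
  split_ifs at h ⊢ with hr <;> subst h <;> rw [Kills] <;> split_ifs <;> simp [h0]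

theorem Node.spaced {v : Bool} {n : ℕ} {W : List ℕ} (h : s.Node v (n + 1) W) :
    Spaced (s.orient (s.region v n W)) := by
  obtain ⟨B, A, rfl, hB, ht⟩ := h.exists_eq
  rw [region_eq hB, orient]
  split_ifs with hr
  · have h1 : s.Allowed v (n + 1) (B ++ [n]) A := by
      refine ⟨fun k hk => ?_, fun _ => Or.inr (by simp)⟩
      rcases Nat.lt_succ_iff_lt_or_eq.mp hk with hk | rfl
      · rw [← s.bad_below hk, below_append, below_cons_of_le le_rfl, below_nil, List.append_nil,
          s.bad_below hk]
        exact ((h.2 n (by omega)).2 B A rfl).1 k hk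
      · rintro ⟨h2, h3⟩
        rw [base] at h2 h3
        split_ifs at h2 h3 with h4
        · obtain rfl := ht h4
          obtain rfl : k = 0 := by
            simp at h2; omega
          rw [after_append_of_notMem (w := []) (by simp)] at h3
          exact not_killsAt (by rw [if_pos hr]) h3
        · rw [after_append_of_notMem hB] at h3
          exact not_killsAt (by rw [if_pos hr]) h3
    obtain ⟨R, hR⟩ := marks_of_pos h1
    refine spaced_of_isChain ?_ ?_
    · rw [List.isChain_reverse]
      refine (marks_isChain _ _ _).imp fun a b => ?_
      tauto
    · rw [List.getLast?_reverse, hR]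
      rfl
  · refine spaced_of_isChain (marks_isChain _ _ _) (marks_getLast? ?_)
    refine ⟨fun k hk => ?_, fun _ => Or.inr (by simp)⟩
    rintro ⟨-, h3⟩
    exact not_killsAt (by rw [if_neg hr]) h3

theorem Node.marks_eq {v : Bool} {n : ℕ} {W : List ℕ} (h : s.Node v (n + 1) W) :
    marks (s.Allowed v (n + 1)) [] W =
      (if s.top then [none, some n] else (W.takeWhile (· ≠ n) ++ [n]).map some) ++
        s.region v n W := by
  obtain ⟨B, A, rfl, hB, ht⟩ := h.exists_eq
  have h1 : (B ++ n :: A).takeWhile (· ≠ n) = B := by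
    rw [List.takeWhile_append_of_pos]
    · simp
    · intro a ha
      have : a ≠ n := fun h' => hB (h' ▸ ha)
      simpa using this
  rw [region_eq hB, h1]
  split_ifs with h2
  · obtain rfl := ht h2
    rw [List.nil_append, marks_cons_pos]
    · rfl
    · exact ⟨fun k _ => by simp [Bad], by simp [h2]⟩
  · rw [marks_of_neg]
    · simp
    · rintro B₁ B₂ rfl ⟨-, h3⟩
      have := h3 (by simpa using h2)
      simp_all

theorem allowed_succ {v : Bool} {d : ℕ} {V₁ V₂ : List ℕ}
    (h : s.top = false → d ∈ V₁ ∧ (d = 0 ∨ d - 1 ∈ V₁)) :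
    s.Allowed v (d + 1) V₁ V₂ ↔ s.Allowed v d V₁ V₂ ∧ ¬ s.Bad v d V₁ V₂ := by
  simp only [Allowed, Nat.lt_succ_iff_lt_or_eq]
  constructor
  · rintro ⟨h1, h2⟩
    exact ⟨⟨fun k hk => h1 k (.inl hk), fun ht => (h ht).2⟩, h1 d (.inr rfl)⟩
  · rintro ⟨⟨h1, h2⟩, h3⟩
    refine ⟨?_, fun ht => Or.inr (h ht).1⟩
    rintro k (hk | rfl)
    exacts [h1 k hk, h3]

theorem flags_orient_prune {v : Bool} {d : ℕ} {X : List (Option ℕ)} {z : List ℕ}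
    (hX : Spaced (s.orient X)) (hd : ∀ a, some a ∈ X → a < d) (hz : z.length = X.count none) :
    flags d (s.orient (prune (s.KillsAt v d) [] (ins d X z) [])) =
      render (sizes s.p s.q v (flags (d - 1) (s.orient X)) (s.orient z)) := by
  have h := flags_prune_ins (p := s.p) (q := s.q) (v := v) hX (m := d)
    (fun a ha => hd a (s.mem_orient.mp ha)) (y := s.orient z)
    (by rw [length_orient, count_orient, hz]) []
  rw [List.count_nil] at h
  rw [sizes, ← h, orient, orient, orient]
  split_ifs with hr
  · have hK : s.KillsAt v d = fun a b => Kills s.p s.q v d b.reverse a.reverse := by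
      funext a b
      rw [KillsAt, if_pos hr]
    simp [prune_reverse, ins_reverse hz, hK]
  · have hK : s.KillsAt v d = Kills s.p s.q v d := by
      funext a b
      rw [KillsAt, if_neg hr]
    rw [hK]

end Shape

/-- Add one to the first entry. -/
def bump : List ℕ → List ℕ
  | [] => []
  | x :: z => (x + 1) :: z

namespace Shape

variable (s : Shape)

/-- `i` and `z` describe a nonempty insertion into `l` gaps of a region. -/
def Valid (l i : ℕ) (z : List ℕ) : Prop :=
  if s.top then z.length = l else z.length + i = l ∧ z ≠ []

/-- The numbers of letters inserted at all the gaps of a word. -/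
def enc (i : ℕ) (z : List ℕ) : List ℕ :=
  if s.top then (i + 1) :: z else List.replicate i 0 ++ bump z

/-- The flags of the gaps remaining after the first inserted letter. -/
def cut (c : List Bool) (i : ℕ) : List Bool :=
  if s.top then c else if s.rev then c.take (c.length - i - 1) ++ [true] else c.drop i

/-- The state obtained from the state `c` by an insertion. -/
def next (v : Bool) (c : List Bool) (i : ℕ) (z : List ℕ) : List Bool :=
  if s.top then
    if s.rev then render (sizes s.p s.q v (s.cut c i) (s.orient z)) ++ flagBlock (i + 1)
    else flagBlock (i + 1) ++ render (sizes s.p s.q v (s.cut c i) (s.orient z))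
  else render (sizes s.p s.q v (s.cut c i) (s.orient z))

/-- The insertion that has the same effect for the other pattern. -/
def twist (v : Bool) (c : List Bool) (i : ℕ) (z : List ℕ) : List ℕ :=
  s.orient (rearrange s.p s.q v (s.cut c i) (s.orient z))

/-- The result of an insertion of letters `d`. -/
noncomputable def child (v : Bool) (d : ℕ) (W : List ℕ) (i : ℕ) (z : List ℕ) : List ℕ :=
  word (ins d (marks (s.Allowed v d) [] W) (s.enc i z))

variable {s}

theorem length_twist (v : Bool) (c : List Bool) (i : ℕ) (z : List ℕ) :
    (s.twist v c i z).length = z.length := by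
  rw [twist, length_orient, length_rearrange, length_orient]

theorem Valid.twist {l i : ℕ} {z : List ℕ} (h : s.Valid l i z) (v : Bool) (c : List Bool) :
    s.Valid l i (s.twist v c i z) := by
  rw [Valid, length_twist, ← List.length_pos_iff, length_twist, List.length_pos_iff]
  exact h

theorem twist_twist (v : Bool) (c : List Bool) (i : ℕ) (z : List ℕ) :
    s.twist (!v) c i (s.twist v c i z) = z := by
  rw [twist, twist, orient_orient, rearrange_rearrange, orient_orient]

theorem Valid.length_cut {i : ℕ} {c : List Bool} {z : List ℕ} (h : s.Valid c.length i z) :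
    (s.cut c i).length = z.length := by
  rw [Valid] at h
  rw [cut]
  split_ifs at h ⊢
  · exact h.symm
  · have := List.length_pos_iff.mpr h.2
    simp
    omega
  · simp
    omega

theorem next_twist {v : Bool} {i : ℕ} {c : List Bool} {z : List ℕ} (h : s.Valid c.length i z) :
    s.next (!v) c i (s.twist v c i z) = s.next v c i z := by
  have h' : (s.cut c i).length = (s.orient z).length := by rw [h.length_cut, length_orient]
  simp only [next, twist, orient_orient, render_sizes_rearrange s.p s.q v h']

theorem Valid.sum_enc {l i : ℕ} {z : List ℕ} (h : s.Valid l i z) :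
    (s.enc i z).sum = i * (if s.top then 1 else 0) + 1 + z.sum := by
  rw [Valid] at h
  rw [enc]
  split_ifs at h ⊢
  · simp
  · obtain ⟨x, z, rfl⟩ := List.exists_cons_of_ne_nil h.2
    simp [bump]
    omega

theorem Valid.sum_enc_twist {l i : ℕ} {z : List ℕ} (h : s.Valid l i z) (v : Bool)
    (c : List Bool) : (s.enc i (s.twist v c i z)).sum = (s.enc i z).sum := by
  rw [h.sum_enc, (h.twist v c).sum_enc, Shape.twist, sum_orient, sum_rearrange, sum_orient]

theorem Valid.length_enc {l i : ℕ} {z : List ℕ} (h : s.Valid l i z) :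
    (s.enc i z).length = l + if s.top then 1 else 0 := by
  rw [Valid] at h
  rw [enc]
  split_ifs at h ⊢
  · simp [h]
  · obtain ⟨x, z, rfl⟩ := List.exists_cons_of_ne_nil h.2
    simp [bump, ← h.1]
    omega

theorem Valid.enc_inj {l i i' : ℕ} {z z' : List ℕ} (h : s.Valid l i z) (h' : s.Valid l i' z')
    (he : s.enc i z = s.enc i' z') : i = i' ∧ z = z' := by
  rw [Valid] at h h'
  rw [enc, enc] at he
  split_ifs at h h' he
  · simpa using he
  · obtain ⟨x, z, rfl⟩ := List.exists_cons_of_ne_nil h.2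
    obtain ⟨x', z', rfl⟩ := List.exists_cons_of_ne_nil h'.2
    clear h h'
    simp only [bump] at he
    induction i generalizing i' with
    | zero =>
      cases i' with
      | zero => simpa using he
      | succ i' => simp [List.replicate_succ] at he
    | succ i ih =>
      cases i' with
      | zero => simp [List.replicate_succ] at he
      | succ i' =>
        simp only [List.replicate_succ, List.cons_append, List.cons.injEq, true_and] at he
        simpa using ih he

theorem exists_replicate_bump {x : List ℕ} (h : 0 < x.sum) :
    ∃ i z, z ≠ [] ∧ x = List.replicate i 0 ++ bump z := by
  induction x with
  | nil => simp at h
  | cons x₀ x ih =>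
    cases x₀ with
    | succ x₀ => exact ⟨0, x₀ :: x, by simp, rfl⟩
    | zero =>
      obtain ⟨i, z, hz, rfl⟩ := ih (by simpa using h)
      exact ⟨i + 1, z, hz, rfl⟩

theorem Node.count_marks {v : Bool} {n : ℕ} {W : List ℕ} (h : s.Node v (n + 1) W) :
    (marks (s.Allowed v (n + 1)) [] W).count none =
      (s.state v n W).length + if s.top then 1 else 0 := by
  rw [h.marks_eq, length_state, List.count_append]
  split_ifs
  · simp [add_comm]
  · simp [List.count_eq_zero]

theorem Node.isInsertion {v : Bool} {n i : ℕ} {W z : List ℕ} (h : s.Node v (n + 1) W)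
    (hz : s.Valid (s.state v n W).length i z) :
    IsInsertion (n + 1) (s.Allowed v (n + 1)) [] W
      (ins (n + 1) (marks (s.Allowed v (n + 1)) [] W) (s.enc i z)) :=
  isInsertion_ins (s.allowed_below le_rfl) h.1 (by rw [h.count_marks, hz.length_enc]) rfl

theorem Node.length_child {v : Bool} {n i : ℕ} {W z : List ℕ} (h : s.Node v (n + 1) W)
    (hz : s.Valid (s.state v n W).length i z) :
    (s.child v (n + 1) W i z).length = W.length + (s.enc i z).sum := by
  rw [child, length_word_ins (by rw [h.count_marks, hz.length_enc]), word_marks]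

theorem Node.child {v : Bool} {n i : ℕ} {W z : List ℕ} (h : s.Node v (n + 1) W)
    (hz : s.Valid (s.state v n W).length i z) : s.Node v (n + 2) (s.child v (n + 1) W i z) := by
  obtain ⟨h1, h2, h3, h4⟩ := h.isInsertion hz
  rw [node_succ, Shape.child, h1]
  refine ⟨h, h3, ?_, by simpa using h4⟩
  rw [Fits]
  split_ifs with ht
  · rw [below_eq_self fun a ha => Nat.lt_succ_iff.mpr (h3 a ha), h.marks_eq, if_pos ht, enc,
      if_pos ht]
    simp [ins, block]
  · rw [← List.count_pos_iff, count_word_ins, hz.sum_enc]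
    · omega
    · intro h5
      have : n + 1 ∈ word (marks (s.Allowed v (n + 1)) [] W) :=
        List.reduceOption_mem_iff.mpr h5
      rw [word_marks] at this
      exact absurd (h.1 _ this) (by simp)
    · rw [h.count_marks, hz.length_enc]

theorem Node.exists_child {v : Bool} {n : ℕ} {W V : List ℕ} (h : s.Node v (n + 1) W)
    (hV : s.Node v (n + 2) V) (hW : below (n + 1) V = W) :
    ∃ i z, s.Valid (s.state v n W).length i z ∧ V = s.child v (n + 1) W i z := by
  subst hW
  rw [node_succ] at hV
  obtain ⟨-, h2, h3, h4⟩ := hV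
  obtain ⟨x, hx, hx'⟩ := exists_marks_eq_ins (P := s.Allowed v (n + 1)) (V := []) (W := V)
    (s.allowed_below le_rfl) h2 (by simpa using h4)
  rw [below_nil] at hx hx'
  have h5 : V = word (ins (n + 1) (marks (s.Allowed v (n + 1)) [] (below (n + 1) V)) x) := by
    rw [← hx', word_marks]
  have h0 := h.count_marks
  rw [Fits] at h3
  suffices ∃ i z, s.Valid (s.state v n (below (n + 1) V)).length i z ∧ x = s.enc i z by
    obtain ⟨i, z, h6, rfl⟩ := this
    exact ⟨i, z, h6, h5⟩
  split_ifs at h3 h0 with ht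
  · rw [h0] at hx
    obtain ⟨x₀, z, rfl⟩ : ∃ x₀ z, x = x₀ :: z := by
      cases x with
      | nil => simp at hx
      | cons x₀ z => exact ⟨_, _, rfl⟩
    rw [below_eq_self fun a ha => Nat.lt_succ_iff.mpr (h2 a ha), h5, h.marks_eq, if_pos ht] at h3
    cases x₀ with
    | zero => simp [ins, block] at h3
    | succ i => exact ⟨i, z, by simpa [Valid, ht] using hx, by simp [enc, ht]⟩
  · have h6 : 0 < x.sum := by
      rw [h5, ← List.count_pos_iff, count_word_ins _ hx] at h3
      · exact h3
      · intro h5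
        have : n + 1 ∈ word (marks (s.Allowed v (n + 1)) [] (below (n + 1) V)) :=
          List.reduceOption_mem_iff.mpr h5
        rw [word_marks] at this
        exact absurd (h.1 _ this) (by simp)
    obtain ⟨i, z, hz, rfl⟩ := exists_replicate_bump h6
    refine ⟨i, z, ?_, by simp [enc, ht]⟩
    rw [Valid, if_neg ht]
    refine ⟨?_, hz⟩
    obtain ⟨y, z, rfl⟩ := List.exists_cons_of_ne_nil hz
    simp [bump] at hx ⊢
    omega

theorem region_eq_prune {v : Bool} {d : ℕ} {B A : List ℕ} (hB : d ∉ B)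
    (h : s.top = false → d = 0 ∨ d - 1 ∈ B) :
    s.region v d (B ++ d :: A) =
      prune (s.Bad v d) (B ++ [d]) (marks (s.Allowed v d) (B ++ [d]) A) [] := by
  rw [region_eq hB]
  refine marks_eq_prune fun A' B' _ => allowed_succ fun ht => ⟨by simp, (h ht).imp_right ?_⟩
  simp +contextual

end Shape

theorem exists_append_gap {T : List (Option ℕ)} {i : ℕ} (h : i < T.count none) :
    ∃ T₁ T₂, T = T₁ ++ none :: T₂ ∧ T₁.count none = i := by
  induction T generalizing i with
  | nil => simp at h
  | cons t T ih =>
    cases t with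
    | some a =>
      obtain ⟨T₁, T₂, rfl, hT⟩ := ih (by simpa using h)
      exact ⟨some a :: T₁, T₂, rfl, by simpa using hT⟩
    | none =>
      cases i with
      | zero => exact ⟨[], T, rfl, rfl⟩
      | succ i =>
        obtain ⟨T₁, T₂, rfl, hT⟩ := ih (i := i) (by simpa using h)
        exact ⟨none :: T₁, T₂, rfl, by simpa using hT⟩

theorem word_map_some (l : List ℕ) : word (l.map some) = l := by
  induction l with
  | nil => rfl
  | cons a l ih => simp [ih]

theorem ins_map_some (m : ℕ) (l : List ℕ) (D : List (Option ℕ)) (x : List ℕ) :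
    ins m (l.map some ++ D) x = l.map some ++ ins m D x := by
  induction l with
  | nil => rfl
  | cons a l ih => simp [ins, ih]

namespace Shape

variable {s : Shape}

theorem Node.lt_of_mem_region {v : Bool} {n a : ℕ} {W : List ℕ} (h : s.Node v (n + 1) W)
    (ha : some a ∈ s.region v n W) : a < n + 1 := by
  refine h.1 a ?_
  have : a ∈ word (marks (s.Allowed v (n + 1)) [] W) := by
    rw [h.marks_eq, word_append, List.mem_append]
    exact Or.inr (List.reduceOption_mem_iff.mpr ha)
  rwa [word_marks] at this

theorem Node.state_child_top {v : Bool} {n i : ℕ} {W z : List ℕ} (h : s.Node v (n + 1) W)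
    (hz : s.Valid (s.state v n W).length i z) (ht : s.top = true) :
    s.state v (n + 1) (s.child v (n + 1) W i z) = s.next v (s.state v n W) i z := by
  have hm := h.marks_eq
  rw [if_pos ht] at hm
  set T := s.region v n W with hT
  have hz' : z.length = T.count none := by
    rwa [Valid, if_pos ht, length_state] at hz
  set V := word (ins (n + 1) (marks (s.Allowed v (n + 1)) [] W) (i :: z)) with hV
  have h1 : s.child v (n + 1) W i z = [] ++ (n + 1) :: V := by
    rw [Shape.child, enc, if_pos ht, hV, hm]
    simp [ins, block]
  have h2 : marks (s.Allowed v (n + 1)) ([] ++ [n + 1]) V =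
      ins (n + 1) (marks (s.Allowed v (n + 1)) [] W) (i :: z) :=
    (isInsertion_ins (s.allowed_below le_rfl) h.1
      (by rw [h.count_marks, length_state, if_pos ht, List.length_cons, hz'])
      (by simp [below_cons_of_le])).2.1
  have h3 : s.region v (n + 1) (s.child v (n + 1) W i z) =
      (none :: block (n + 1) i) ++ some n ::
        prune (s.KillsAt v (n + 1)) [] (ins (n + 1) T z) [] := by
    have h4 : word (none :: block (n + 1) i) = List.replicate i (n + 1) := by
      rw [word_none, word_block]
    have h5 : n ∉ [n + 1] ++ List.replicate i (n + 1) := by simp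
    rw [h1, region_eq_prune (by simp) (by simp [ht]), h2, hm]
    simp only [List.cons_append, List.nil_append, ins]
    rw [← List.cons_append, prune_append, h4, prune_eq_self, prune]
    · rw [List.cons_append]
      congr 3
      refine prune_congr fun A B => ?_
      have h6 : s.base (n + 1) = n := by simp [base, ht]
      rw [Bad, h6, List.append_assoc _ [n], show [n] ++ A = n :: A from rfl,
        after_append_of_notMem h5]
      simp
    · rintro A B hA ⟨h6, -⟩
      rw [h4] at hA
      have h7 : s.base (n + 1) = n := by simp [base, ht]
      rw [h7, List.mem_append] at h6
      rcases h6 with h6 | h6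
      · simp at h6
      · have := hA.subset h6
        simp at this
  have h8 := flags_orient_prune (v := v) h.spaced (fun a => h.lt_of_mem_region) hz'
  have h9 : flags (n + 1) (none :: block (n + 1) i) = flagBlock (i + 1) := by
    have : (block (n + 1) i).count none = i := by
      clear * -
      induction i with
      | zero => rfl
      | succ i ih => simp [block, ih]
    rw [flags_of_forall, List.count_cons_self, this]
    simpa using block_forall (n + 1) i
  rw [state, h3, next, if_pos ht, cut, if_pos ht, state, ← hT]
  rw [Nat.add_sub_cancel] at h8
  rw [← h8, orient]
  split_ifs with hr
  · rw [List.reverse_append, none_block_reverse, List.reverse_cons, List.append_assoc,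
      List.singleton_append, flags_append_some (by omega), h9, orient, if_pos hr]
  · rw [flags_append_some (by omega), h9, orient, if_neg hr]

theorem Node.state_child_bottom {v : Bool} {n i : ℕ} {W z : List ℕ} (h : s.Node v (n + 1) W)
    (hz : s.Valid (s.state v n W).length i z) (ht : s.top = false) :
    s.state v (n + 1) (s.child v (n + 1) W i z) = s.next v (s.state v n W) i z := by
  have ht' : ¬ s.top = true := by simp [ht]
  have hm := h.marks_eq
  rw [if_neg ht'] at hm
  set B := W.takeWhile (· ≠ n) ++ [n] with hB
  have hT := hz
  rw [Valid, if_neg ht', length_state] at hT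
  have hz0 := List.length_pos_iff.mpr hT.2
  obtain ⟨T₁, T₂, hT', rfl⟩ := exists_append_gap (T := s.region v n W) (i := i) (by omega)
  have hsp := h.spaced
  have hlt : ∀ a, some a ∈ none :: T₂ → a < n + 1 := fun a ha =>
    h.lt_of_mem_region (by rw [hT']; exact List.mem_append_right _ ha)
  rw [hT'] at hm hT hsp
  have hz' : z.length = (none :: T₂).count none := by
    have := hT.1
    rw [List.count_append] at this
    omega
  obtain ⟨x, z', hxz⟩ := List.exists_cons_of_ne_nil hT.2
  set A := word (ins (n + 1) (none :: T₂) z) with hA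
  have h1 : s.child v (n + 1) W (T₁.count none) z = (B ++ word T₁) ++ (n + 1) :: A := by
    rw [Shape.child, enc, if_neg ht', hm, ins_map_some, ins_append (by simp), ins_replicate_zero,
      hA, hxz]
    simp [bump, ins, block, word_map_some]
  have h2 : B ++ word T₁ ++ word (none :: T₂) = W := by
    rw [← word_marks (s.Allowed v (n + 1)) [] W, hm]
    simp [word_map_some]
  have h3 : ∀ a ∈ B ++ word T₁ ++ word (none :: T₂), a < n + 1 := h2.symm ▸ h.1
  have hd : n + 1 ∉ B ++ word T₁ := fun h' =>
    absurd (h3 (n + 1) (List.mem_append_left _ h')) (by simp)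
  have h4 : marks (s.Allowed v (n + 1)) (B ++ word T₁) (word T₂) = none :: T₂ := by
    have := marks_suffix (T₁ := B.map some ++ T₁) (T₂ := T₂) (by rw [hm, List.append_assoc])
    simpa [word_map_some] using this
  have h5 : marks (s.Allowed v (n + 1)) (B ++ word T₁ ++ [n + 1]) A =
      ins (n + 1) (none :: T₂) z := by
    have := (isInsertion_ins (d := n + 1) (P := s.Allowed v (n + 1)) (W := word T₂) (x := z)
      (V₀ := B ++ word T₁) (V := B ++ word T₁ ++ [n + 1]) (s.allowed_below le_rfl)
      (fun a ha => h3 a (by simp [ha])) (by rw [h4, hz'])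
      (by rw [below_append, below_cons_of_le le_rfl, below_nil, List.append_nil,
        below_eq_self fun a ha => h3 a (List.mem_append_left _ ha)])).2.1
    rwa [h4] at this
  have h6 : s.region v (n + 1) (s.child v (n + 1) W (T₁.count none) z) =
      prune (s.KillsAt v (n + 1)) [] (ins (n + 1) (none :: T₂) z) [] := by
    rw [h1, region_eq_prune hd (by simp [hB]), h5]
    refine prune_congr fun A' B' => ?_
    have h7 : s.base (n + 1) = n + 1 := by simp [base, ht]
    rw [Bad, h7, List.append_assoc _ [n + 1], List.singleton_append, after_append_of_notMem hd]
    simp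
  have h7 : Spaced (s.orient (none :: T₂)) := by
    rw [orient] at hsp ⊢
    split_ifs at hsp ⊢
    · rw [List.reverse_append, List.reverse_cons, List.append_assoc] at hsp
      rw [List.reverse_cons]
      exact hsp.append_left
    · exact hsp.of_append
  have h8 : s.cut (s.state v n W) (T₁.count none) = flags n (s.orient (none :: T₂)) := by
    rw [cut, if_neg ht', length_state, hT', state, hT', orient, orient]
    split_ifs
    · have : (T₁ ++ none :: T₂).count none - T₁.count none - 1 = T₂.reverse.count none := by
        rw [List.count_append, List.count_cons_self, List.count_reverse]
        omega
      rw [this, List.reverse_append, List.reverse_cons, List.append_assoc, List.singleton_append,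
        flags_append_take]
    · exact flags_append_drop _ _ _
  rw [state, h6, flags_orient_prune h7 hlt hz', next, if_neg ht', h8, Nat.add_sub_cancel]

theorem Node.state_child {v : Bool} {n i : ℕ} {W z : List ℕ} (h : s.Node v (n + 1) W)
    (hz : s.Valid (s.state v n W).length i z) :
    s.state v (n + 1) (s.child v (n + 1) W i z) = s.next v (s.state v n W) i z := by
  cases ht : s.top with
  | true => exact h.state_child_top hz ht
  | false => exact h.state_child_bottom hz ht

end Shape

namespace Shape

variable {s : Shape}

theorem Node.mem_iff {v : Bool} {d c : ℕ} {V : List ℕ} (h : s.Node v d V) : c ∈ V ↔ c < d := by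
  refine ⟨h.1 c, fun hc => ?_⟩
  have := (h.2 c hc).1
  rw [Fits] at this
  split_ifs at this
  · exact (mem_below.mp (List.mem_of_mem_head? this)).1
  · exact this

theorem Node.unique {v v' : Bool} {d d' : ℕ} {V : List ℕ} (h : s.Node v d V)
    (h' : s.Node v' d' V) : d = d' := by
  refine eq_of_forall_lt_iff fun c => ?_
  rw [← h.mem_iff, h'.mem_iff]

theorem allowed_one (v v' : Bool) : s.Allowed v 1 = s.Allowed v' 1 := by
  have h : ∀ v V₁ V₂, ¬ s.Bad v 0 V₁ V₂ := by
    rintro v V₁ V₂ ⟨-, h⟩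
    rw [KillsAt, Kills, Kills] at h
    simp [HasLow] at h
  funext V₁ V₂
  simp [Allowed, h]

theorem node_one {v v' : Bool} {V : List ℕ} (h : s.Node v 1 V) : s.Node v' 1 V := by
  refine ⟨h.1, fun c hc => ⟨(h.2 c hc).1, fun V₁ V₂ hV => ?_⟩⟩
  obtain rfl : c = 0 := by omega
  simp [Allowed]

theorem exists_map_node (v : Bool) (n : ℕ) : ∃ φ : List ℕ → List ℕ,
    (∀ V, s.Node v (n + 1) V → s.Node (!v) (n + 1) (φ V) ∧ (φ V).length = V.length ∧
      s.state (!v) n (φ V) = s.state v n V) ∧ Set.InjOn φ {V | s.Node v (n + 1) V} := by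
  induction n with
  | zero =>
    refine ⟨id, fun V hV => ⟨node_one hV, rfl, ?_⟩, Set.injOn_id _⟩
    rw [id, state, state, region, region, allowed_one]
  | succ n ih =>
    obtain ⟨φ, hφ, hinj⟩ := ih
    have h : ∀ V, ∃ V', s.Node v (n + 2) V →
        ∃ i z, s.Valid (s.state v n (below (n + 1) V)).length i z ∧
          V = s.child v (n + 1) (below (n + 1) V) i z ∧
          V' = s.child (!v) (n + 1) (φ (below (n + 1) V)) i
            (s.twist v (s.state v n (below (n + 1) V)) i z) := by
      intro V
      by_cases hV : s.Node v (n + 2) V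
      · obtain ⟨i, z, h1, h2⟩ := (s.node_succ.mp hV).1.exists_child hV rfl
        exact ⟨_, fun _ => ⟨i, z, h1, h2, rfl⟩⟩
      · exact ⟨[], fun h => absurd h hV⟩
    choose ψ hψ using h
    refine ⟨ψ, fun V hV => ?_, fun V hV V' hV' he => ?_⟩
    · obtain ⟨i, z, hz, h1, h2⟩ := hψ V hV
      have hW := (s.node_succ.mp hV).1
      generalize below (n + 1) V = W at *
      obtain ⟨h3, h4, h5⟩ := hφ W hW
      have hz' : s.Valid (s.state (!v) n (φ W)).length i (s.twist v (s.state v n W) i z) := by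
        rw [h5]
        exact hz.twist _ _
      rw [h2, h3.length_child hz', h3.state_child hz', h5, next_twist hz, h4, hz.sum_enc_twist,
        h1, hW.length_child hz, hW.state_child hz]
      exact ⟨h3.child hz', rfl, rfl⟩
    · obtain ⟨i, z, hz, h1, h2⟩ := hψ V hV
      obtain ⟨i', z', hz', h1', h2'⟩ := hψ V' hV'
      have hW := (s.node_succ.mp hV).1
      have hW' := (s.node_succ.mp hV').1
      generalize below (n + 1) V = W at *
      generalize below (n + 1) V' = W' at *
      obtain ⟨h3, h4, h5⟩ := hφ W hW
      obtain ⟨h3', h4', h5'⟩ := hφ W' hW'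
      have ht := hz.twist v (s.state v n W)
      have ht' := hz'.twist v (s.state v n W')
      have hI := h3.isInsertion (by rwa [h5])
      have hI' := h3'.isInsertion (by rwa [h5'])
      rw [h2, h2', child, child] at he
      have hWW : W = W' := hinj hW hW' (by rw [← hI.1, ← hI'.1, he])
      subst hWW
      have hins := hI.2.1
      rw [he, hI'.2.1] at hins
      have hl := h3.count_marks
      rw [h5] at hl
      have henc := ins_inj (by
        intro h6
        have : n + 1 ∈ word (marks (s.Allowed (!v) (n + 1)) [] (φ W)) :=
          List.reduceOption_mem_iff.mpr h6
        rw [word_marks] at this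
        exact absurd (h3.1 _ this) (by simp))
        (by rw [ht'.length_enc, hl]) (by rw [ht.length_enc, hl]) hins
      obtain ⟨rfl, h7⟩ := ht'.enc_inj ht henc
      have h8 := congrArg (s.twist (!v) (s.state v n W) i') h7
      rw [twist_twist, twist_twist] at h8
      rw [h1, h1', h8]

variable (s)

/-- The words of length `N` that encode avoiders. -/
def nodes (v : Bool) (N : ℕ) : Set (List ℕ) := {V | V.length = N ∧ ∃ d, s.Node v d V}

theorem encard_nodes_le (v : Bool) (N : ℕ) : (s.nodes v N).encard ≤ (s.nodes (!v) N).encard := by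
  choose φ hφ hinj using fun n => exists_map_node (s := s) v n
  have h : ∀ V, ∃ V', ∀ d, s.Node v d V → s.Node (!v) d V' ∧ V'.length = V.length ∧
      V' = if d = 0 then [] else φ (d - 1) V := by
    intro V
    by_cases hV : ∃ d, s.Node v d V
    · obtain ⟨d, hd⟩ := hV
      cases d with
      | zero =>
        have hV : V = [] := List.eq_nil_iff_forall_not_mem.mpr fun a ha => absurd (hd.1 a ha)
          (by simp)
        subst hV
        refine ⟨[], fun d' hd' => ?_⟩
        obtain rfl := hd.unique hd'
        exact ⟨⟨by simp, by simp⟩, rfl, rfl⟩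
      | succ n =>
        refine ⟨φ n V, fun d' hd' => ?_⟩
        obtain rfl := hd.unique hd'
        obtain ⟨h1, h2, -⟩ := hφ n V hd
        exact ⟨h1, h2, rfl⟩
    · exact ⟨[], fun d hd => absurd ⟨d, hd⟩ hV⟩
  choose ψ hψ using h
  refine Set.encard_le_encard_of_injOn (f := ψ) ?_ ?_
  · rintro V ⟨hV, d, hd⟩
    obtain ⟨h1, h2, -⟩ := hψ V d hd
    exact ⟨h2.trans hV, d, h1⟩
  · rintro V ⟨-, d, hd⟩ V' ⟨-, d', hd'⟩ he
    obtain ⟨h1, h2, h3⟩ := hψ V d hd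
    obtain ⟨h1', h2', h3'⟩ := hψ V' d' hd'
    obtain rfl : d = d' := h1.unique (he ▸ h1')
    cases d with
    | zero =>
      have : ∀ V, s.Node v 0 V → V = [] := fun V hd =>
        List.eq_nil_iff_forall_not_mem.mpr fun a ha => absurd (hd.1 a ha) (by simp)
      rw [this V hd, this V' hd']
    | succ n =>
      rw [if_neg (by simp)] at h3 h3'
      exact hinj n hd hd' (h3.symm.trans (he.trans h3'))

theorem ncard_nodes (v : Bool) (N : ℕ) : (s.nodes v N).ncard = (s.nodes (!v) N).ncard := by
  rw [Set.ncard_def, Set.ncard_def, le_antisymm (s.encard_nodes_le v N)]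
  simpa using s.encard_nodes_le (!v) N

end Shape

theorem append_cons_sublist_iff {X Y U : List ℕ} {f : ℕ} :
    (X ++ f :: Y).Sublist U ↔ ∃ A B, U = A ++ f :: B ∧ X.Sublist A ∧ Y.Sublist B := by
  constructor
  · intro h
    obtain ⟨A, B', rfl, hX, h⟩ := List.append_sublist_iff.mp h
    obtain ⟨A', B, rfl, hf, hY⟩ := List.cons_sublist_iff.mp h
    obtain ⟨A₁, A₂, rfl⟩ := List.append_of_mem hf
    exact ⟨A ++ A₁, A₂ ++ B, by simp, hX.trans (List.sublist_append_left _ _),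
      hY.trans (List.sublist_append_right _ _)⟩
  · rintro ⟨A, B, rfl, hX, hY⟩
    exact hX.append (hY.cons_cons f)

theorem cons_sublist_iff_after {r : ℕ} {l w : List ℕ} :
    (r :: l).Sublist w ↔ r ∈ w ∧ l.Sublist (after r w) := by
  constructor
  · intro h
    have hr : r ∈ w := h.subset (by simp)
    refine ⟨hr, ?_⟩
    obtain ⟨A, B, rfl, hA⟩ := List.eq_append_cons_of_mem hr
    rw [after_append_of_notMem hA]
    clear hr
    induction A with
    | nil => simpa using h
    | cons a A ih =>
      rw [List.cons_append, List.cons_sublist_cons'] at h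
      rcases h with h | ⟨rfl, -⟩
      · exact ih (fun h' => hA (by simp [h'])) h
      · simp at hA
  · rintro ⟨hr, h⟩
    obtain ⟨A, B, rfl, hA⟩ := List.eq_append_cons_of_mem hr
    rw [after_append_of_notMem hA] at h
    exact (h.cons_cons r).trans (List.sublist_append_right _ _)

namespace Shape

variable (s : Shape)

/-- The part of the pattern outside the letter `f`, see `Shape.run`. -/
def outer (v : Bool) (k : ℕ) : List ℕ := if v then [] else List.replicate s.p k

/-- The part of the pattern beyond the letter `f`, see `Shape.run`. -/
def inner (v : Bool) (k o : ℕ) : List ℕ :=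
  (if v then List.replicate s.p k else []) ++ o :: List.replicate s.q k

/-- The pattern without its initial run of increasing letters. -/
def run (v : Bool) (k f o : ℕ) : List ℕ := s.orient (s.outer v k ++ f :: s.inner v k o)

variable {s}

theorem map_run (v : Bool) (k f o : ℕ) (g : ℕ → ℕ) :
    (s.run v k f o).map g = s.run v (g k) (g f) (g o) := by
  simp only [run, orient, outer, inner]
  split_ifs <;> simp

theorem mem_run_fst (v : Bool) (k f o : ℕ) : f ∈ s.run v k f o := by
  simp [run, mem_orient]

theorem mem_run_snd (v : Bool) (k f o : ℕ) : o ∈ s.run v k f o := by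
  simp [run, mem_orient, inner]

theorem kills_iff {v : Bool} {k : ℕ} {V₁ V₂ : List ℕ} :
    Kills s.p s.q v k V₁ V₂ ↔
      ∃ o, o + 1 < k ∧ (s.outer v k).Sublist V₁ ∧ (s.inner v k o).Sublist V₂ := by
  rw [Kills]
  cases v with
  | true => simp [outer, inner, HasLow]
  | false =>
    simp only [outer, inner, HasLow, Bool.false_eq_true, if_false, List.replicate_zero,
      ← List.replicate_sublist_iff]
    exact ⟨fun ⟨h, o, ho, h'⟩ => ⟨o, ho, h, h'⟩, fun ⟨o, ho, h, h'⟩ => ⟨h, o, ho, h'⟩⟩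

theorem exists_killsAt_iff {v : Bool} {k f : ℕ} {U : List ℕ} :
    (∃ V₁ V₂, U = V₁ ++ f :: V₂ ∧ s.KillsAt v k V₁ V₂) ↔
      ∃ o, o + 1 < k ∧ (s.run v k f o).Sublist U := by
  simp only [KillsAt, run, orient]
  split_ifs
  · simp only [kills_iff, List.reverse_append, List.reverse_cons, List.append_assoc,
      List.singleton_append, append_cons_sublist_iff]
    constructor
    · rintro ⟨V₁, V₂, rfl, o, ho, h1, h2⟩
      exact ⟨o, ho, V₁, V₂, rfl, by simpa using h2.reverse, by simpa using h1.reverse⟩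
    · rintro ⟨o, ho, V₁, V₂, rfl, h1, h2⟩
      exact ⟨V₁, V₂, rfl, o, ho, by simpa using h2.reverse, by simpa using h1.reverse⟩
  · simp only [kills_iff, append_cons_sublist_iff]
    constructor
    · rintro ⟨V₁, V₂, rfl, o, ho, h1, h2⟩
      exact ⟨o, ho, V₁, V₂, rfl, h1, h2⟩
    · rintro ⟨o, ho, V₁, V₂, rfl, h1, h2⟩
      exact ⟨V₁, V₂, rfl, o, ho, h1, h2⟩

theorem exists_bad_iff {v : Bool} {k f : ℕ} {V : List ℕ} :
    (∃ V₁ V₂, V = V₁ ++ f :: V₂ ∧ s.Bad v k V₁ V₂) ↔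
      ∃ o, o + 1 < k ∧ (s.base k :: s.run v k f o).Sublist V := by
  have h : (∃ o, o + 1 < k ∧ (s.base k :: s.run v k f o).Sublist V) ↔
      s.base k ∈ V ∧ ∃ o, o + 1 < k ∧ (s.run v k f o).Sublist (after (s.base k) V) := by
    simp only [cons_sublist_iff_after]
    exact ⟨fun ⟨o, ho, h, h'⟩ => ⟨h, o, ho, h'⟩, fun ⟨h, o, ho, h'⟩ => ⟨o, ho, h, h'⟩⟩
  rw [h, ← exists_killsAt_iff]
  constructor
  · rintro ⟨V₁, V₂, rfl, h1, h2⟩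
    exact ⟨by simp [h1], after (s.base k) V₁, V₂, after_append_of_mem h1 _, h2⟩
  · rintro ⟨h1, V₁, V₂, h2, h3⟩
    obtain ⟨A, B, rfl, hA⟩ := List.eq_append_cons_of_mem h1
    rw [after_append_of_notMem hA] at h2
    subst h2
    refine ⟨A ++ s.base k :: V₁, V₂, by simp, by simp, ?_⟩
    rwa [after_append_of_notMem hA]

theorem node_iff {v : Bool} {d : ℕ} {V : List ℕ} (hV : ∀ a ∈ V, a < d) :
    s.Node v d V ↔ ((∀ c < d, s.Fits c V) ∧
      (s.top = false → ∀ V₁ c V₂, V = V₁ ++ c :: V₂ → c = 0 ∨ c - 1 ∈ V₁)) ∧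
      ∀ k f o, o + 1 < k → k < f → ¬ (s.base k :: s.run v k f o).Sublist V := by
  have h : ∀ {V₁ c V₂}, V = V₁ ++ c :: V₂ → c < d := fun h => hV _ (by simp [h])
  constructor
  · rintro ⟨-, h2⟩
    refine ⟨⟨fun c hc => (h2 c hc).1, fun ht V₁ c V₂ hc => ((h2 c (h hc)).2 V₁ V₂ hc).2 ht⟩, ?_⟩
    intro k f o ho hf hs
    obtain ⟨V₁, V₂, hf', hb⟩ := exists_bad_iff.mpr ⟨o, ho, hs⟩
    exact ((h2 f (h hf')).2 V₁ V₂ hf').1 k hf hb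
  · rintro ⟨⟨h1, h2⟩, h3⟩
    refine ⟨hV, fun c hc => ⟨h1 c hc, fun V₁ V₂ hc' =>
      ⟨fun k hk hb => ?_, fun ht => h2 ht V₁ c V₂ hc'⟩⟩⟩
    obtain ⟨o, ho, hs⟩ := exists_bad_iff.mp ⟨V₁, V₂, hc', hb⟩
    exact h3 k c o ho hk hs

end Shape

theorem le_foldr_max {l : List ℕ} {a : ℕ} (h : a ∈ l) : a ≤ l.foldr max 0 := by
  induction l with
  | nil => simp at h
  | cons b l ih =>
    rcases List.mem_cons.mp h with rfl | h
    · simp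
    · exact (ih h).trans (by simp)

theorem foldr_max_mem {l : List ℕ} (h : l.foldr max 0 ≠ 0) : l.foldr max 0 ∈ l := by
  induction l with
  | nil => simp at h
  | cons b l ih =>
    rw [List.foldr_cons] at h ⊢
    rcases max_choice b (l.foldr max 0) with h' | h'
    · simp [h']
    · rw [h'] at h ⊢
      exact List.mem_cons_of_mem _ (ih h)

theorem isCanonicalSeq_iff_le {π : List ℕ} :
    IsCanonicalSeq π ↔
      ∀ π₁ a π₂, π = π₁ ++ a :: π₂ → 1 ≤ a ∧ a ≤ π₁.foldr max 0 + 1 := by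
  constructor
  · rintro h π₁ a π₂ rfl
    simpa using h π₁.length (by simp)
  · intro h i hi
    have := h (π.take i) (π.get ⟨i, hi⟩) (π.drop (i + 1)) (by simp)
    exact this

theorem isCanonicalSeq_iff {π : List ℕ} :
    IsCanonicalSeq π ↔
      ∀ π₁ a π₂, π = π₁ ++ a :: π₂ → 1 ≤ a ∧ ∀ b, 1 ≤ b → b < a → b ∈ π₁ := by
  rw [isCanonicalSeq_iff_le]
  constructor
  · intro h
    have key : ∀ π₁ π₂, π = π₁ ++ π₂ → ∀ b, 1 ≤ b → b ≤ π₁.foldr max 0 → b ∈ π₁ := by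
      intro π₁
      induction π₁ using List.reverseRecOn with
      | nil => simp; omega
      | append_singleton A a ih =>
        intro π₂ hπ b hb hb'
        have h1 := h A a π₂ (by simpa using hπ)
        have h2 := ih (a :: π₂) (by simpa using hπ) b hb
        by_cases h3 : b ≤ A.foldr max 0
        · simp [h2 h3]
        · have h4 := foldr_max_mem (l := A ++ [a]) (by omega)
          rw [List.mem_append, List.mem_singleton] at h4
          rcases h4 with h4 | h4
          · exact absurd (hb'.trans (le_foldr_max h4)) h3
          · obtain rfl : b = a := by omega
            simp
    intro π₁ a π₂ hπ
    have h1 := h _ _ _ hπ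
    exact ⟨h1.1, fun b hb hb' => key _ _ hπ b hb (by omega)⟩
  · intro h π₁ a π₂ hπ
    have h1 := h _ _ _ hπ
    refine ⟨h1.1, ?_⟩
    by_cases ha : a = 1
    · omega
    · have := le_foldr_max (h1.2 (a - 1) (by omega) (by omega))
      omega

theorem containsPat_iff {π σ : List ℕ} :
    ContainsPat π σ ↔
      ∃ g : ℕ → ℕ, (∀ a ∈ σ, ∀ b ∈ σ, a < b → g a < g b) ∧ (σ.map g).Sublist π := by
  constructor
  · rintro ⟨f, hf, h⟩
    have hex : ∀ a, ∃ x, ∀ i, σ.get i = a → π.get (f i) = x := by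
      intro a
      by_cases ha : a ∈ σ
      · obtain ⟨i, hi⟩ := List.get_of_mem ha
        refine ⟨π.get (f i), fun j hj => ?_⟩
        have h1 := h i j
        have h2 := h j i
        omega
      · exact ⟨0, fun i hi => absurd (hi ▸ List.get_mem σ i) ha⟩
    choose g hg using hex
    refine ⟨g, ?_, ?_⟩
    · intro a ha b hb hab
      obtain ⟨i, rfl⟩ := List.get_of_mem ha
      obtain ⟨j, rfl⟩ := List.get_of_mem hb
      rw [← hg _ i rfl, ← hg _ j rfl]
      exact (h i j).mp hab
    · rw [List.sublist_iff_exists_fin_orderEmbedding_get_eq]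
      refine ⟨(Fin.castOrderIso (by simp)).toOrderEmbedding.trans
        (OrderEmbedding.ofStrictMono f hf), fun i => ?_⟩
      have := hg _ (Fin.cast (by simp) i) rfl
      simp at this ⊢
      exact this.symm
  · rintro ⟨g, hg, h⟩
    rw [List.sublist_iff_exists_fin_orderEmbedding_get_eq] at h
    obtain ⟨f, hf⟩ := h
    refine ⟨fun i => f (Fin.cast (by simp) i), fun i j hij => f.strictMono (by simpa using hij),
      fun i j => ?_⟩
    rw [← hf, ← hf]
    simp only [List.get_eq_getElem, List.getElem_map, Fin.val_cast]
    have hmem : ∀ i : Fin σ.length, σ[i.1] ∈ σ := fun i => List.getElem_mem _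
    refine ⟨hg _ (hmem i) _ (hmem j), fun h' => ?_⟩
    by_contra h''
    rcases (not_lt.mp h'').eq_or_lt with h3 | h3
    · rw [h3] at h'
      exact lt_irrefl _ h'
    · exact lt_asymm h' (hg _ (hmem j) _ (hmem i) h3)

theorem IsCanonicalSeq.cons_sublist {π l : List ℕ} {b c : ℕ} (h : IsCanonicalSeq π) (hb : 1 ≤ b)
    (hbc : b ≤ c) (hl : (c :: l).Sublist π) : (b :: l).Sublist π := by
  obtain ⟨A, B, rfl, -, hB⟩ := append_cons_sublist_iff (X := []).mp hl
  rcases hbc.eq_or_lt with rfl | hbc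
  · exact hl
  · have := (isCanonicalSeq_iff.mp h _ _ _ rfl).2 b hb hbc
    exact (List.singleton_sublist.mpr this).append (hB.cons c)

theorem IsCanonicalSeq.append_sublist {π l : List ℕ} {a b c : ℕ} (h : IsCanonicalSeq π)
    (ha : a ∈ π) (hab : a < b) (hbc : b < c) (hl : (c :: l).Sublist π) :
    (a :: b :: c :: l).Sublist π := by
  have h' := isCanonicalSeq_iff.mp h
  have ha₁ : 1 ≤ a := by
    obtain ⟨A, B, hA⟩ := List.append_of_mem ha
    exact (h' _ _ _ hA).1
  obtain ⟨A, B, rfl, -, hB⟩ := append_cons_sublist_iff (X := []).mp hl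
  have hb := (h' _ _ _ rfl).2 b (by omega) hbc
  obtain ⟨A₁, A₂, rfl⟩ := List.append_of_mem hb
  have ha := (h' A₁ b (A₂ ++ c :: B) (by simp)).2 a ha₁ hab
  exact (((List.singleton_sublist.mpr ha).append
    ((List.nil_sublist A₂).cons_cons b)).append (hB.cons_cons c))

namespace Shape

variable (s : Shape)

/-- The pattern with parameters `s`, on the side `v` of the equivalence. -/
def pattern (v : Bool) : List ℕ :=
  1 :: 2 :: 3 :: if s.top then s.run v 2 1 4 else s.run v 3 4 1

variable {s}

theorem eq_of_mem_run {v : Bool} {k f o x : ℕ} (h : x ∈ s.run v k f o) :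
    x = k ∨ x = f ∨ x = o := by
  simp only [run, outer, inner, mem_orient] at h
  split_ifs at h <;> simp at h <;> tauto

theorem containsPat_pattern_iff {v : Bool} {π : List ℕ} :
    ContainsPat π (s.pattern v) ↔
      ∃ a b c e, a < b ∧ b < c ∧ c < e ∧
        (a :: b :: c :: if s.top then s.run v b a e else s.run v c e a).Sublist π := by
  have hrun : ∀ g : ℕ → ℕ, (s.pattern v).map g = g 1 :: g 2 :: g 3 ::
      if s.top then s.run v (g 2) (g 1) (g 4) else s.run v (g 3) (g 4) (g 1) := by
    intro g
    simp only [pattern, List.map_cons]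
    split_ifs <;> simp [map_run]
  have hmem : ∀ x, x ∈ s.pattern v ↔ x = 1 ∨ x = 2 ∨ x = 3 ∨ x = 4 := by
    intro x
    simp only [pattern, List.mem_cons]
    split_ifs
    · have := mem_run_snd (s := s) v 2 1 4
      have := eq_of_mem_run (s := s) (v := v) (k := 2) (f := 1) (o := 4) (x := x)
      constructor
      · tauto
      · rintro (rfl | rfl | rfl | rfl) <;> tauto
    · have := mem_run_fst (s := s) v 3 4 1
      have := eq_of_mem_run (s := s) (v := v) (k := 3) (f := 4) (o := 1) (x := x)
      constructor
      · tauto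
      · rintro (rfl | rfl | rfl | rfl) <;> tauto
  simp only [containsPat_iff, hmem, hrun]
  constructor
  · rintro ⟨g, hg, h⟩
    exact ⟨g 1, g 2, g 3, g 4, hg _ (by simp) _ (by simp) (by simp),
      hg _ (by simp) _ (by simp) (by simp), hg _ (by simp) _ (by simp) (by simp), h⟩
  · rintro ⟨a, b, c, e, hab, hbc, hce, h⟩
    refine ⟨fun x => if x = 1 then a else if x = 2 then b else if x = 3 then c else e, ?_,
      by simpa using h⟩
    rintro x (rfl | rfl | rfl | rfl) y (rfl | rfl | rfl | rfl) hxy <;> simp at hxy ⊢ <;> omega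

theorem containsPat_pattern_top {v : Bool} {π : List ℕ} (ht : s.top = true)
    (h : IsCanonicalSeq π) :
    ContainsPat π (s.pattern v) ↔
      ∃ a b e, a < b ∧ b + 2 ≤ e ∧ ((b + 1) :: s.run v b a e).Sublist π := by
  simp only [containsPat_pattern_iff, ht, if_true]
  constructor
  · rintro ⟨a, b, c, e, hab, hbc, hce, hs⟩
    exact ⟨a, b, e, hab, by omega, h.cons_sublist (by omega) hbc
      (((List.sublist_append_right [a, b] _)).trans hs)⟩
  · rintro ⟨a, b, e, hab, hbe, hs⟩
    exact ⟨a, b, b + 1, e, hab, by omega, by omega, h.append_sublist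
      (hs.subset (List.mem_cons_of_mem _ (mem_run_fst _ _ _ _))) hab (by omega) hs⟩

theorem containsPat_pattern_bottom {v : Bool} {π : List ℕ} (ht : s.top = false)
    (h : IsCanonicalSeq π) :
    ContainsPat π (s.pattern v) ↔
      ∃ a c e, a + 2 ≤ c ∧ c < e ∧ (c :: s.run v c e a).Sublist π := by
  simp only [containsPat_pattern_iff, ht, Bool.false_eq_true, if_false]
  constructor
  · rintro ⟨a, b, c, e, hab, hbc, hce, hs⟩
    exact ⟨a, c, e, by omega, hce, ((List.sublist_append_right [a, b] _)).trans hs⟩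
  · rintro ⟨a, c, e, hac, hce, hs⟩
    exact ⟨a, a + 1, c, e, by omega, by omega, hce, h.append_sublist
      (hs.subset (List.mem_cons_of_mem _ (mem_run_snd _ _ _ _))) (by omega) (by omega) hs⟩

end Shape

theorem isCanonicalSeq_map_iff {V : List ℕ} {u : ℕ → ℕ} :
    IsCanonicalSeq (V.map u) ↔ ∀ V₁ x V₂, V = V₁ ++ x :: V₂ →
      1 ≤ u x ∧ ∀ b, 1 ≤ b → b < u x → ∃ y ∈ V₁, u y = b := by
  rw [isCanonicalSeq_iff]
  constructor
  · rintro h V₁ x V₂ rfl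
    simpa using h (V₁.map u) (u x) (V₂.map u) (by simp)
  · intro h π₁ a π₂ hπ
    obtain ⟨V₁, V', rfl, rfl, hV⟩ := List.map_eq_append_iff.mp hπ
    obtain ⟨x, V₂, rfl, rfl, rfl⟩ := List.map_eq_cons_iff.mp hV
    simpa using h V₁ x V₂ rfl

theorem pred_mem_iff {V : List ℕ} :
    (∀ V₁ x V₂, V = V₁ ++ x :: V₂ → x = 0 ∨ x - 1 ∈ V₁) ↔
      ∀ V₁ x V₂, V = V₁ ++ x :: V₂ → ∀ y < x, y ∈ V₁ := by
  constructor
  · intro h V₁ x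
    induction x generalizing V₁ with
    | zero => simp
    | succ x ih =>
      intro V₂ hV y hy
      have hx : x ∈ V₁ := by simpa using h _ _ _ hV
      rcases (Nat.lt_succ_iff.mp hy).eq_or_lt with rfl | hy
      · exact hx
      · obtain ⟨A, B, rfl⟩ := List.append_of_mem hx
        exact List.mem_append_left _ (ih A (B ++ (x + 1) :: V₂) (by simpa using hV) y hy)
  · intro h V₁ x V₂ hV
    rcases Nat.eq_zero_or_pos x with rfl | hx
    · exact Or.inl rfl
    · exact Or.inr (h _ _ _ hV _ (by omega))

namespace Shape

variable {s : Shape}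

theorem forall_fits_iff_of_top {d : ℕ} {V : List ℕ} (ht : s.top = true) :
    (∀ c < d, s.Fits c V) ↔ (∀ c < d, c ∈ V) ∧
      ∀ V₁ x V₂, V = V₁ ++ x :: V₂ → ∀ y < d, x < y → y ∈ V₁ := by
  simp only [Fits, ht, if_true]
  constructor
  · refine fun h => ⟨fun c hc => (mem_below.mp (List.mem_of_mem_head? (h c hc))).1, ?_⟩
    rintro V₁ x V₂ rfl y hy hxy
    have := h y hy
    rw [below_append, below_cons_of_lt (by omega)] at this
    cases hV : below (y + 1) V₁ with
    | nil =>
      simp only [hV, List.nil_append, List.head?_cons, Option.some.injEq] at this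
      omega
    | cons z l =>
      simp only [hV, List.cons_append, List.head?_cons, Option.some.injEq] at this
      subst this
      exact (mem_below.mp (hV ▸ List.mem_cons_self)).1
  · rintro ⟨h, h'⟩ c hc
    have hmem : c ∈ below (c + 1) V := mem_below.mpr ⟨h c hc, by omega⟩
    cases hV : below (c + 1) V with
    | nil => simp [hV] at hmem
    | cons x l =>
      obtain ⟨V₁, V₂, rfl, h1, h2, -⟩ := List.filter_eq_cons_iff.mp hV
      have h3 := h' _ _ _ rfl c hc
      by_cases h4 : x < c
      · simpa using h1 c (h3 h4)
      · simp only [decide_eq_true_eq] at h2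
        obtain rfl : x = c := by omega
        simp

variable (s)

/-- The letter of the canonical sequence on `d` letters that a letter of a word stands for. -/
def unshift (d x : ℕ) : ℕ := if s.top then d - x else x + 1

/-- The letter of a word that stands for a letter of a canonical sequence on `d` letters. -/
def shift (d x : ℕ) : ℕ := if s.top then d - x else x - 1

variable {s}

theorem shift_unshift {d x : ℕ} (h : x < d) : s.shift d (s.unshift d x) = x := by
  simp only [shift, unshift]
  split_ifs <;> omega

theorem unshift_shift {d x : ℕ} (h : 1 ≤ x) (h' : x ≤ d) : s.unshift d (s.shift d x) = x := by
  simp only [shift, unshift]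
  split_ifs <;> omega

theorem map_shift_map_unshift {d : ℕ} {V : List ℕ} (hV : ∀ a ∈ V, a < d) :
    (V.map (s.unshift d)).map (s.shift d) = V := by
  rw [List.map_map]
  exact (List.map_congr_left fun a ha => shift_unshift (hV a ha)).trans (List.map_id V)

theorem map_unshift_map_shift {d : ℕ} {π : List ℕ} (hπ : ∀ a ∈ π, 1 ≤ a ∧ a ≤ d) :
    (π.map (s.shift d)).map (s.unshift d) = π := by
  rw [List.map_map]
  exact (List.map_congr_left fun a ha => unshift_shift (hπ a ha).1 (hπ a ha).2).trans
    (List.map_id π)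

theorem fits_iff_isCanonicalSeq {d : ℕ} {V : List ℕ} (hV : ∀ a ∈ V, a < d) :
    ((∀ c < d, s.Fits c V) ∧
      (s.top = false → ∀ V₁ c V₂, V = V₁ ++ c :: V₂ → c = 0 ∨ c - 1 ∈ V₁)) ↔
    (∀ c < d, c ∈ V) ∧ IsCanonicalSeq (V.map (s.unshift d)) := by
  have hlt : ∀ {V₁ c V₂}, V = V₁ ++ c :: V₂ → c < d := fun h => hV _ (by simp [h])
  rw [isCanonicalSeq_map_iff]
  cases ht : s.top with
  | true =>
    simp only [forall_fits_iff_of_top ht, unshift, ht, if_true, Bool.true_eq_false,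
      false_imp_iff, and_true]
    refine and_congr_right fun _ => forall₄_congr fun V₁ x V₂ h => ?_
    have hx := hlt h
    constructor
    · exact fun h' => ⟨by omega, fun b hb hb' => ⟨d - b, h' _ (by omega) (by omega), by omega⟩⟩
    · intro h' y hy hxy
      obtain ⟨z, hz, hzy⟩ := h'.2 (d - y) (by omega) (by omega)
      have := hV z (by simp [h, hz])
      obtain rfl : z = y := by omega
      exact hz
  | false =>
    simp only [pred_mem_iff, Fits, unshift, ht, Bool.false_eq_true, if_false, forall_const]
    refine and_congr_right fun _ => forall₄_congr fun V₁ x V₂ h => ?_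
    constructor
    · exact fun h' => ⟨by omega, fun b hb hb' => ⟨b - 1, h' _ (by omega), by omega⟩⟩
    · intro h' y hy
      obtain ⟨z, hz, hzy⟩ := h'.2 (y + 1) (by omega) (by omega)
      obtain rfl : z = y := by omega
      exact hz

theorem run_sublist_iff_containsPat {v : Bool} {d : ℕ} {V : List ℕ} (hV : ∀ a ∈ V, a < d)
    (h : IsCanonicalSeq (V.map (s.unshift d))) :
    (∃ k f o, o + 1 < k ∧ k < f ∧ (s.base k :: s.run v k f o).Sublist V) ↔
      ContainsPat (V.map (s.unshift d)) (s.pattern v) := by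
  have hu : ∀ {r k f o}, (r :: s.run v k f o).Sublist V →
      (s.unshift d r :: s.run v (s.unshift d k) (s.unshift d f) (s.unshift d o)).Sublist
        (V.map (s.unshift d)) := fun h => by simpa [map_run] using h.map (s.unshift d)
  have hs : ∀ {r k f o}, (r :: s.run v k f o).Sublist (V.map (s.unshift d)) →
      (s.shift d r :: s.run v (s.shift d k) (s.shift d f) (s.shift d o)).Sublist V := fun h => by
    have := h.map (s.shift d)
    rwa [map_shift_map_unshift hV, List.map_cons, map_run] at this
  have hpos : ∀ a ∈ V.map (s.unshift d), 1 ≤ a := fun a ha => by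
    obtain ⟨A, B, hA⟩ := List.append_of_mem ha
    exact (isCanonicalSeq_iff.mp h _ _ _ hA).1
  cases ht : s.top with
  | true =>
    rw [containsPat_pattern_top ht h]
    simp only [unshift, shift, base, ht, if_true] at hu hs hpos ⊢
    constructor
    · rintro ⟨k, f, o, hok, hkf, h'⟩
      have hf := hV f (h'.subset (by simp [mem_run_fst]))
      refine ⟨d - f, d - k, d - o, by omega, by omega, ?_⟩
      have := hu h'
      rwa [show d - (k - 1) = d - k + 1 by omega] at this
    · rintro ⟨a, b, e, hab, hbe, h'⟩
      have hle : ∀ x ∈ V.map (s.unshift d), x ≤ d := by simp [unshift, ht]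
      have ha := hpos a (h'.subset (by simp [mem_run_fst]))
      have he := hle e (h'.subset (by simp [mem_run_snd]))
      refine ⟨d - b, d - a, d - e, by omega, by omega, ?_⟩
      have := hs h'
      rwa [Nat.sub_add_eq] at this
  | false =>
    rw [containsPat_pattern_bottom ht h]
    simp only [unshift, shift, base, ht, Bool.false_eq_true, if_false] at hu hs hpos ⊢
    constructor
    · rintro ⟨k, f, o, hok, hkf, h'⟩
      exact ⟨o + 1, k + 1, f + 1, by omega, by omega, hu h'⟩
    · rintro ⟨a, c, e, hac, hce, h'⟩
      have ha := hpos a (h'.subset (by simp [mem_run_snd]))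
      exact ⟨c - 1, e - 1, a - 1, by omega, by omega, hs h'⟩

theorem node_iff_isCanonicalSeq {v : Bool} {d : ℕ} {V : List ℕ} (hV : ∀ a ∈ V, a < d) :
    s.Node v d V ↔ (∀ c < d, c ∈ V) ∧ IsCanonicalSeq (V.map (s.unshift d)) ∧
      AvoidsPat (V.map (s.unshift d)) (s.pattern v) := by
  rw [node_iff hV, fits_iff_isCanonicalSeq hV, and_assoc]
  refine and_congr_right fun _ => and_congr_right fun h => ?_
  rw [AvoidsPat, ← run_sublist_iff_containsPat hV h]
  push Not
  rfl

theorem pAvoid_pattern (v : Bool) (n : ℕ) : pAvoid n (s.pattern v) = (s.nodes v n).ncard := by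
  have hbound : ∀ {π : List ℕ}, IsCanonicalSeq π → ∀ a ∈ π, 1 ≤ a ∧ a ≤ π.foldr max 0 := by
    intro π h a ha
    obtain ⟨A, B, hA⟩ := List.append_of_mem ha
    exact ⟨(isCanonicalSeq_iff.mp h _ _ _ hA).1, le_foldr_max ha⟩
  have hnode : ∀ {π : List ℕ}, IsCanonicalSeq π → AvoidsPat π (s.pattern v) →
      s.Node v (π.foldr max 0) (π.map (s.shift (π.foldr max 0))) := by
    intro π h h'
    have hb := hbound h
    rw [node_iff_isCanonicalSeq, map_unshift_map_shift hb]
    · refine ⟨fun c hc => ?_, h, h'⟩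
      have hmem : s.unshift (π.foldr max 0) c ∈ π := by
        have hm := foldr_max_mem (l := π) (by omega)
        obtain ⟨A, B, hA⟩ := List.append_of_mem hm
        have h1 := (isCanonicalSeq_iff.mp h _ _ _ hA).2 (s.unshift (π.foldr max 0) c)
        by_cases he : s.unshift (π.foldr max 0) c = π.foldr max 0
        · rwa [he]
        · suffices s.unshift (π.foldr max 0) c ∈ A by
            rw [hA]
            rw [hA] at this
            exact List.mem_append_left _ this
          refine h1 ?_ ?_ <;> revert he <;> simp only [unshift] <;>
            split_ifs <;> omega
      exact List.mem_map.mpr ⟨_, hmem, shift_unshift hc⟩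
    · simp only [List.mem_map, shift]
      rintro _ ⟨a, ha, rfl⟩
      have := hb a ha
      split_ifs <;> omega
  have himage : s.nodes v n = (fun π => π.map (s.shift (π.foldr max 0))) ''
      {π | π.length = n ∧ IsCanonicalSeq π ∧ AvoidsPat π (s.pattern v)} := by
    ext V
    constructor
    · rintro ⟨hn, d, hd⟩
      have h := (node_iff_isCanonicalSeq hd.1).mp hd
      refine ⟨V.map (s.unshift d), ⟨by simpa using hn, h.2⟩, ?_⟩
      have hmax : (V.map (s.unshift d)).foldr max 0 = d := by
        apply le_antisymm
        · by_contra hlt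
          obtain ⟨x, hx, hx'⟩ := List.mem_map.mp
            (foldr_max_mem (l := V.map (s.unshift d)) (by omega))
          have := hd.1 x hx
          rw [unshift] at hx'
          split_ifs at hx' <;> omega
        · rcases Nat.eq_zero_or_pos d with rfl | hpos
          · simp
          · refine le_foldr_max (List.mem_map.mpr ⟨s.shift d d, h.1 _ ?_, ?_⟩)
            · rw [shift]
              split_ifs <;> omega
            · exact unshift_shift hpos le_rfl
      simp only [hmax]
      exact map_shift_map_unshift hd.1
    · rintro ⟨π, ⟨hn, h, h'⟩, rfl⟩
      exact ⟨by simpa using hn, _, hnode h h'⟩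
  rw [himage, Set.InjOn.ncard_image, pAvoid]
  rintro π ⟨-, h1, h1'⟩ π' ⟨-, h2, h2'⟩ heq
  simp only at heq
  have hd := (hnode h1 h1').unique (heq ▸ hnode h2 h2')
  have := congrArg (List.map (s.unshift (π.foldr max 0))) heq
  rwa [map_unshift_map_shift (hbound h1), hd, map_unshift_map_shift (hbound h2)] at this

theorem patEquiv_pattern (s : Shape) : PatEquiv (s.pattern false) (s.pattern true) := fun n => by
  rw [pAvoid_pattern, pAvoid_pattern, s.ncard_nodes false n, Bool.not_false]

end Shape

/-- For all p, q ≥ 0: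
(1) 1232^p142^q ∼ 12312^p42^q; (2) 1232^p412^q ∼ 1232^p42^q1;
(3) 123^(p+1)413^q ∼ 12343^p13^q; (4) 123^(p+1)143^q ∼ 123^(p+1)13^q4. -/
theorem statement15 (p q : ℕ) :
    PatEquiv ([1, 2, 3] ++ List.replicate p 2 ++ [1, 4] ++ List.replicate q 2)
             ([1, 2, 3, 1] ++ List.replicate p 2 ++ [4] ++ List.replicate q 2) ∧
    PatEquiv ([1, 2, 3] ++ List.replicate p 2 ++ [4, 1] ++ List.replicate q 2)
             ([1, 2, 3] ++ List.replicate p 2 ++ [4] ++ List.replicate q 2 ++ [1]) ∧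
    PatEquiv ([1, 2] ++ List.replicate (p + 1) 3 ++ [4, 1] ++ List.replicate q 3)
             ([1, 2, 3, 4] ++ List.replicate p 3 ++ [1] ++ List.replicate q 3) ∧
    PatEquiv ([1, 2] ++ List.replicate (p + 1) 3 ++ [1, 4] ++ List.replicate q 3)
             ([1, 2] ++ List.replicate (p + 1) 3 ++ [1] ++ List.replicate q 3 ++ [4]) := by
  refine ⟨?_, ?_, ?_, ?_⟩
  · convert Shape.patEquiv_pattern ⟨true, false, p, q⟩ using 1 <;>
      simp [Shape.pattern, Shape.run, Shape.orient, Shape.outer, Shape.inner]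
  · convert Shape.patEquiv_pattern ⟨true, true, q, p⟩ using 1 <;>
      simp [Shape.pattern, Shape.run, Shape.orient, Shape.outer, Shape.inner]
  · convert Shape.patEquiv_pattern ⟨false, false, p, q⟩ using 1 <;>
      simp [Shape.pattern, Shape.run, Shape.orient, Shape.outer, Shape.inner, List.replicate_succ]
  · convert Shape.patEquiv_pattern ⟨false, true, q, p⟩ using 1 <;>
      simp [Shape.pattern, Shape.run, Shape.orient, Shape.outer, Shape.inner, List.replicate_succ]
end

section
/- For every n ≥ 0, the number of partitions of [n] whose canonical sequence avoids the pattern 1123 equals the n-th Catalan number C(2n,n)/(n+1). Consequently, the pattern 1123 is equivalent to the pattern 1212, i.e., p(n;1123) = p(n;1212) for all n. -/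
open Finset in
/-- Reassociating a sum over triples of natural numbers with fixed total. -/
theorem sum_antidiagonal_assoc (n : ℕ) (f : ℕ → ℕ → ℕ → ℕ) :
    ∑ p ∈ antidiagonal n, ∑ q ∈ antidiagonal p.2, f p.1 q.1 q.2 =
      ∑ p ∈ antidiagonal n, ∑ q ∈ antidiagonal p.1, f q.1 q.2 p.2 := by
  induction n generalizing f with
  | zero => simp
  | succ n ih =>
    simp only [Nat.sum_antidiagonal_succ (n := n)]
    rw [ih fun a => f (a + 1)]
    simp [Nat.sum_antidiagonal_succ, sum_add_distrib, add_assoc]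

open Finset in
theorem sum_antidiagonal_sum_range (n : ℕ) (h : ℕ → ℕ → ℕ) :
    ∑ p ∈ antidiagonal n, ∑ i ∈ range (p.1 + 1), h i p.2 =
      ∑ j ∈ range (n + 1), ∑ p ∈ antidiagonal j, h p.1 p.2 := by
  induction n with
  | zero => simp
  | succ n ih =>
    rw [sum_range_succ, ← ih, Nat.sum_antidiagonal_succ, Nat.sum_antidiagonal_succ]
    simp only [sum_range_succ _ (_ + 1), sum_add_distrib]
    simp
    ring

/-- The ballot numbers, counting the descendants in `n` generations of a node labelled `k` in
the Catalan tree, where a node labelled `k` has children labelled `1, …, k + 1`. -/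
def ballot : ℕ → ℕ → ℕ
  | 0, _ => 1
  | n + 1, k => ∑ j ∈ Finset.range (k + 1), ballot n (j + 1)

theorem ballot_succ_zero (n : ℕ) : ballot (n + 1) 0 = ballot n 1 := by simp [ballot]

theorem ballot_succ_succ (n k : ℕ) :
    ballot (n + 1) (k + 1) = ballot (n + 1) k + ballot n (k + 2) := by
  simp [ballot, Finset.sum_range_succ _ (k + 1)]

theorem ballot_add_choose (n k : ℕ) :
    ballot n k + (2 * n + k).choose (n + k + 1) = (2 * n + k).choose (n + k) := by
  induction n generalizing k with
  | zero => simp [ballot]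
  | succ n ih =>
    induction k with
    | zero =>
      have h : ballot n 1 + (2 * n + 1).choose (n + 2) = (2 * n + 1).choose (n + 1) := ih 1
      have e : (2 * n + 1).choose n = (2 * n + 1).choose (n + 1) :=
        Nat.choose_symm_of_eq_add (by omega)
      have h1 : (2 * n + 2).choose (n + 1) = (2 * n + 1).choose n + (2 * n + 1).choose (n + 1) :=
        Nat.choose_succ_succ _ _
      have h2 : (2 * n + 2).choose (n + 2) =
          (2 * n + 1).choose (n + 1) + (2 * n + 1).choose (n + 2) := Nat.choose_succ_succ _ _
      rw [ballot_succ_zero]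
      change ballot n 1 + (2 * n + 2).choose (n + 2) = (2 * n + 2).choose (n + 1)
      omega
    | succ k ihk =>
      have h := ih (k + 2)
      have h1 : (2 * n + k + 3).choose (n + k + 2) =
          (2 * n + k + 2).choose (n + k + 1) + (2 * n + k + 2).choose (n + k + 2) :=
        Nat.choose_succ_succ _ _
      have h2 : (2 * n + k + 3).choose (n + k + 3) =
          (2 * n + k + 2).choose (n + k + 2) + (2 * n + k + 2).choose (n + k + 3) :=
        Nat.choose_succ_succ _ _
      rw [ballot_succ_succ]
      rw [show 2 * n + (k + 2) = 2 * n + k + 2 by ring,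
        show n + (k + 2) = n + k + 2 by ring] at h
      rw [show 2 * (n + 1) + k = 2 * n + k + 2 by ring,
        show n + 1 + k = n + k + 1 by ring] at ihk
      rw [show 2 * (n + 1) + (k + 1) = 2 * n + k + 3 by ring,
        show n + 1 + (k + 1) = n + k + 2 by ring]
      simp only [add_assoc (n + k), Nat.reduceAdd] at h ihk ⊢
      omega

theorem ballot_zero_right (n : ℕ) : ballot n 0 = (2 * n).choose n / (n + 1) := by
  have h := ballot_add_choose n 0
  have h2 := Nat.choose_succ_right_eq (2 * n) n
  simp only [add_zero, show 2 * n - n = n by omega] at h h2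
  refine (Nat.div_eq_of_eq_mul_left n.succ_pos ?_).symm
  rw [Nat.succ_eq_add_one]
  nlinarith

open Finset in
theorem ballot_succ_right (n d : ℕ) :
    ballot n (d + 1) = ∑ p ∈ antidiagonal n, ballot p.1 (d + p.2) := by
  induction n generalizing d with
  | zero => simp [ballot]
  | succ n ih =>
    rw [ballot_succ_succ, ih (d + 1), Nat.sum_antidiagonal_succ']
    simp [add_assoc, add_comm 1]

/-- The number of ways to extend by `ℓ` letters, still avoiding 1123, a sequence whose smallest
repeated letter is `r + 1` and whose largest available letter is `r + d + 2`. -/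
def repeatExt : ℕ → ℕ → ℕ → ℕ
  | 0, _, _ => 1
  | ℓ + 1, r, d => ∑ p ∈ Finset.HasAntidiagonal.antidiagonal r, repeatExt ℓ p.1 (d + p.2) +
      ∑ e ∈ Finset.range (d + 1), repeatExt ℓ r e

open Finset in
theorem sum_repeatExt (n d : ℕ) :
    ∑ p ∈ antidiagonal n, repeatExt p.1 p.2 d = ∑ i ∈ range (n + 1), ballot i (d + 1) := by
  induction n using Nat.strong_induction_on generalizing d with
  | _ n ih =>
  cases n with
  | zero => simp [repeatExt, ballot]
  | succ n =>
    have hleft : ∑ p ∈ antidiagonal n, ∑ q ∈ antidiagonal p.2, repeatExt p.1 q.1 (d + q.2) =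
        ∑ j ∈ range (n + 1), ballot j (d + 2) := by
      rw [sum_antidiagonal_assoc n fun a b c => repeatExt a b (d + c)]
      calc _ = ∑ p ∈ antidiagonal n, ∑ i ∈ range (p.1 + 1), ballot i (d + 1 + p.2) := by
            refine sum_congr rfl fun p hp => ?_
            have := mem_antidiagonal.1 hp
            rw [ih p.1 (by omega), add_right_comm]
        _ = _ := by
            rw [sum_antidiagonal_sum_range n fun i b => ballot i (d + 1 + b)]
            simp only [← ballot_succ_right]
    have hright : ∑ p ∈ antidiagonal n, ∑ e ∈ range (d + 1), repeatExt p.1 p.2 e =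
        ∑ j ∈ range (n + 1), ballot (j + 1) d := by
      rw [sum_comm, sum_congr rfl fun e _ => ih n n.lt_succ_self e, sum_comm]
      rfl
    rw [Nat.sum_antidiagonal_succ, sum_range_succ']
    simp only [repeatExt, sum_add_distrib, hleft, hright, ballot_succ_succ]
    simp only [ballot]
    ring

/-- The number of ways to extend the sequence `1, 2, …, m + 1` by `n` letters while
avoiding 1123. -/
def iotaExt : ℕ → ℕ → ℕ
  | 0, _ => 1
  | n + 1, m => iotaExt n (m + 1) + ∑ p ∈ Finset.HasAntidiagonal.antidiagonal m, repeatExt n p.1 p.2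

open Finset in
theorem iotaExt_succ (n m : ℕ) :
    iotaExt (n + 1) m =
      1 + ∑ p ∈ antidiagonal n, ∑ q ∈ antidiagonal (m + p.2), repeatExt p.1 q.1 q.2 := by
  induction n generalizing m with
  | zero => simp [iotaExt]
  | succ n ih =>
    rw [iotaExt, ih, Nat.sum_antidiagonal_succ']
    simp only [add_zero, add_assoc, add_comm 1]
    ring

open Finset in
theorem iotaExt_zero_right (n : ℕ) : iotaExt n 0 = ballot (n + 1) 0 := by
  cases n with
  | zero => simp [iotaExt, ballot]
  | succ n =>
    have hsum : ∑ j ∈ range (n + 1), ballot j 2 + 1 = ballot (n + 1) 1 := by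
      induction n with
      | zero => simp [ballot]
      | succ n ih =>
        rw [sum_range_succ, ballot_succ_succ (n + 1), ballot_succ_zero, ← ih]
        ring
    rw [iotaExt_succ, ballot_succ_zero, ← hsum, add_comm]
    simp only [zero_add]
    rw [sum_antidiagonal_assoc n repeatExt]
    simp only [sum_repeatExt]
    rw [sum_antidiagonal_sum_range n fun i b => ballot i (b + 1)]
    simp only [ballot_succ_right _ 1, add_comm 1]

/-- There are exactly `c` lists `τ` of length `n` such that `π ++ τ` satisfies `Q`. -/
def ExtCount (Q : List ℕ → Prop) (π : List ℕ) (n c : ℕ) : Prop :=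
  ∃ F : Finset (List ℕ), (∀ τ, τ ∈ F ↔ τ.length = n ∧ Q (π ++ τ)) ∧ F.card = c

theorem ExtCount.zero {Q : List ℕ → Prop} {π : List ℕ} (h : Q π) : ExtCount Q π 0 1 :=
  ⟨{[]}, fun τ => by
    rw [Finset.mem_singleton, List.length_eq_zero_iff]
    exact ⟨fun e => ⟨e, by simpa [e] using h⟩, And.left⟩, rfl⟩

theorem ExtCount.succ {Q : List ℕ → Prop} (hQ : ∀ π τ, Q (π ++ τ) → Q π) {π : List ℕ} {n : ℕ}
    {c : ℕ → ℕ} (L : Finset ℕ) (hL : ∀ x, Q (π ++ [x]) ↔ x ∈ L)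
    (hc : ∀ x ∈ L, ExtCount Q (π ++ [x]) n (c x)) :
    ExtCount Q π (n + 1) (∑ x ∈ L, c x) := by
  choose! F hF hcard using hc
  refine ⟨L.biUnion fun x => (F x).map ⟨List.cons x, List.cons_injective⟩, fun τ => ?_, ?_⟩
  · simp only [Finset.mem_biUnion, Finset.mem_map, Function.Embedding.coeFn_mk]
    constructor
    · rintro ⟨x, hx, τ, hτ, rfl⟩
      have := (hF x hx τ).1 hτ
      simpa using this
    · rintro ⟨hlen, hτ⟩
      cases τ with
      | nil => simp at hlen
      | cons x τ =>
        have hτ' : Q (π ++ [x] ++ τ) := by simpa using hτ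
        have hx := (hL x).1 (hQ _ _ hτ')
        exact ⟨x, hx, τ, (hF x hx τ).2 ⟨by simpa using hlen, hτ'⟩, rfl⟩
  · rw [Finset.card_biUnion]
    · exact Finset.sum_congr rfl fun x hx => by rw [Finset.card_map, hcard x hx]
    · intro x _ y _ hxy
      rw [Function.onFun, Finset.disjoint_left]
      simp only [Finset.mem_map, Function.Embedding.coeFn_mk]
      rintro _ ⟨_, _, rfl⟩ ⟨_, _, h⟩
      exact hxy (List.cons.inj h).1.symm

theorem ExtCount.ncard_eq {Q : List ℕ → Prop} {n c : ℕ} (h : ExtCount Q [] n c) :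
    Set.ncard {π | π.length = n ∧ Q π} = c := by
  obtain ⟨F, hF, rfl⟩ := h
  rw [← Set.ncard_coe_finset]
  congr 1
  ext τ
  simpa using (hF τ).symm

/-- A subsequence of `π ++ [x]` either lies in `π` or uses the final `x`. -/
theorem concat_sublist_concat {ρ π : List ℕ} {x y : ℕ} :
    (ρ ++ [y]).Sublist (π ++ [x]) ↔ (ρ ++ [y]).Sublist π ∨ ρ.Sublist π ∧ y = x := by
  rw [← List.reverse_sublist]
  simp only [List.reverse_append, List.reverse_singleton, List.singleton_append]
  rw [List.sublist_cons_iff]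
  constructor
  · rintro (h | ⟨r, h, hr⟩)
    · left
      rw [← List.reverse_sublist]
      simpa using h
    · right
      obtain ⟨rfl, rfl⟩ := List.cons.inj h
      exact ⟨List.reverse_sublist.1 hr, rfl⟩
  · rintro (h | ⟨h, rfl⟩)
    · left
      rw [← List.reverse_sublist] at h
      simpa using h
    · exact Or.inr ⟨_, rfl, List.reverse_sublist.2 h⟩

theorem containsPat_1123_iff {π : List ℕ} :
    ContainsPat π [1, 1, 2, 3] ↔ ∃ a b c, a < b ∧ b < c ∧ [a, a, b, c].Sublist π := by
  constructor
  · rintro ⟨f, hf, h⟩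
    have h01 := h 0 1
    have h10 := h 1 0
    have h12 := h 1 2
    have h23 := h 2 3
    simp at h01 h10 h12 h23
    have he : π.get (f 0) = π.get (f 1) := le_antisymm h10 h01
    refine ⟨π.get (f 1), π.get (f 2), π.get (f 3), h12, h23, ?_⟩
    rw [List.sublist_iff_exists_fin_orderEmbedding_get_eq]
    refine ⟨OrderEmbedding.ofStrictMono f hf, fun i => ?_⟩
    fin_cases i
    exacts [he.symm, rfl, rfl, rfl]
  · rintro ⟨a, b, c, hab, hbc, h⟩
    obtain ⟨f, hf⟩ := List.sublist_iff_exists_fin_orderEmbedding_get_eq.1 h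
    refine ⟨f, f.strictMono, fun i j => ?_⟩
    rw [← hf i, ← hf j]
    fin_cases i <;> fin_cases j <;> simp <;> omega

theorem containsPat_1212_iff {π : List ℕ} :
    ContainsPat π [1, 2, 1, 2] ↔ ∃ a b, a < b ∧ [a, b, a, b].Sublist π := by
  constructor
  · rintro ⟨f, hf, h⟩
    have h02 := h 0 2
    have h20 := h 2 0
    have h13 := h 1 3
    have h31 := h 3 1
    have h01 := h 0 1
    simp at h01 h02 h20 h13 h31
    have he : π.get (f 2) = π.get (f 0) := le_antisymm h02 h20
    have he' : π.get (f 3) = π.get (f 1) := le_antisymm h13 h31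
    refine ⟨π.get (f 0), π.get (f 1), h01, ?_⟩
    rw [List.sublist_iff_exists_fin_orderEmbedding_get_eq]
    refine ⟨OrderEmbedding.ofStrictMono f hf, fun i => ?_⟩
    fin_cases i
    exacts [rfl, rfl, he.symm, he'.symm]
  · rintro ⟨a, b, hab, h⟩
    obtain ⟨f, hf⟩ := List.sublist_iff_exists_fin_orderEmbedding_get_eq.1 h
    refine ⟨f, f.strictMono, fun i j => ?_⟩
    rw [← hf i, ← hf j]
    fin_cases i <;> fin_cases j <;> simp <;> omega

theorem AvoidsPat.of_append {π τ σ : List ℕ} (h : AvoidsPat (π ++ τ) σ) : AvoidsPat π σ := by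
  rintro ⟨f, hf, hσ⟩
  refine h ⟨fun i => Fin.castLE (by simp) (f i), fun i j hij => hf hij, fun i j => ?_⟩
  rw [hσ i j]
  simp [List.getElem_append_left]

theorem foldr_max_concat (π : List ℕ) (x : ℕ) :
    (π ++ [x]).foldr max 0 = max (π.foldr max 0) x := by
  induction π with
  | nil => simp
  | cons y π ih => simp only [List.cons_append, List.foldr_cons, ih, max_assoc]

theorem isCanonicalSeq_nil : IsCanonicalSeq [] := fun i h => by simp at h

theorem isCanonicalSeq_concat {π : List ℕ} {x : ℕ} :
    IsCanonicalSeq (π ++ [x]) ↔ IsCanonicalSeq π ∧ 1 ≤ x ∧ x ≤ π.foldr max 0 + 1 := by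
  constructor
  · refine fun h => ⟨fun i hi => ?_, ?_⟩
    · have := h i (by simp; omega)
      simpa [List.getElem_append_left hi, List.take_append_of_le_length hi.le] using this
    · simpa using h π.length (by simp)
  · rintro ⟨h, hx⟩ i hi
    rcases Nat.lt_or_ge i π.length with hi' | hi'
    · simpa [List.getElem_append_left hi', List.take_append_of_le_length hi'.le] using h i hi'
    · obtain rfl : i = π.length := by simp at hi; omega
      simpa using hx

theorem IsCanonicalSeq.of_append {π τ : List ℕ} (h : IsCanonicalSeq (π ++ τ)) :
    IsCanonicalSeq π := by
  induction τ using List.reverseRecOn with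
  | nil => simpa using h
  | append_singleton τ x ih =>
    rw [← List.append_assoc] at h
    exact ih (isCanonicalSeq_concat.1 h).1

theorem IsCanonicalSeq.mem_iff {π : List ℕ} (h : IsCanonicalSeq π) (y : ℕ) :
    y ∈ π ↔ 1 ≤ y ∧ y ≤ π.foldr max 0 := by
  induction π using List.reverseRecOn with
  | nil => simp; omega
  | append_singleton π x ih =>
    obtain ⟨hπ, hx⟩ := isCanonicalSeq_concat.1 h
    rw [foldr_max_concat, List.mem_append, ih hπ, List.mem_singleton]
    omega

/-- The first occurrences of letters in a canonical sequence come in increasing order. -/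
theorem IsCanonicalSeq.pair_sublist {π : List ℕ} (h : IsCanonicalSeq π) {x y : ℕ} (hx : 1 ≤ x)
    (hxy : x < y) (hy : y ≤ π.foldr max 0) : [x, y].Sublist π := by
  induction π using List.reverseRecOn with
  | nil => simp at hy; omega
  | append_singleton π z ih =>
    obtain ⟨hπ, hz⟩ := isCanonicalSeq_concat.1 h
    rw [foldr_max_concat] at hy
    refine (concat_sublist_concat (ρ := [x])).2 ?_
    rcases Nat.lt_or_ge (π.foldr max 0) y with hlt | hle
    · exact Or.inr ⟨List.singleton_sublist.2 ((hπ.mem_iff x).2 (by omega)), by omega⟩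
    · exact Or.inl (ih hπ hle)

/-- `π` is the canonical sequence of a partition avoiding `σ`. -/
def IsAvoider (σ π : List ℕ) : Prop := IsCanonicalSeq π ∧ AvoidsPat π σ

theorem IsAvoider.of_append {σ : List ℕ} (π τ : List ℕ) (h : IsAvoider σ (π ++ τ)) :
    IsAvoider σ π :=
  ⟨h.1.of_append, h.2.of_append⟩

theorem isAvoider_nil {σ : List ℕ} (hσ : σ ≠ []) : IsAvoider σ [] := by
  refine ⟨isCanonicalSeq_nil, fun ⟨f, _⟩ => ?_⟩
  exact absurd (f ⟨0, List.length_pos_iff.2 hσ⟩).2 (by simp)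

theorem isAvoider_1212_concat {π : List ℕ} {x : ℕ} :
    IsAvoider [1, 2, 1, 2] (π ++ [x]) ↔ IsAvoider [1, 2, 1, 2] π ∧
      (1 ≤ x ∧ x ≤ π.foldr max 0 + 1) ∧ ¬ ∃ a < x, [a, x, a].Sublist π := by
  have key : ContainsPat (π ++ [x]) [1, 2, 1, 2] ↔
      ContainsPat π [1, 2, 1, 2] ∨ ∃ a < x, [a, x, a].Sublist π := by
    have hs (a b : ℕ) : [a, b, a, b].Sublist (π ++ [x]) ↔
        [a, b, a, b].Sublist π ∨ [a, b, a].Sublist π ∧ b = x :=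
      concat_sublist_concat (ρ := [a, b, a])
    simp only [containsPat_1212_iff, hs]
    constructor
    · rintro ⟨a, b, hab, h | ⟨h, rfl⟩⟩
      exacts [Or.inl ⟨a, b, hab, h⟩, Or.inr ⟨a, hab, h⟩]
    · rintro (⟨a, b, hab, h⟩ | ⟨a, hax, h⟩)
      exacts [⟨a, b, hab, Or.inl h⟩, ⟨a, x, hax, Or.inr ⟨h, rfl⟩⟩]
  simp only [IsAvoider, AvoidsPat, key, isCanonicalSeq_concat, not_or]
  tauto

theorem isAvoider_1123_concat {π : List ℕ} {x : ℕ} :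
    IsAvoider [1, 1, 2, 3] (π ++ [x]) ↔ IsAvoider [1, 1, 2, 3] π ∧
      (1 ≤ x ∧ x ≤ π.foldr max 0 + 1) ∧ ∀ a b, a < b → [a, a, b].Sublist π → x ≤ b := by
  have key : ContainsPat (π ++ [x]) [1, 1, 2, 3] ↔
      ContainsPat π [1, 1, 2, 3] ∨ ∃ a b, a < b ∧ b < x ∧ [a, a, b].Sublist π := by
    have hs (a b c : ℕ) : [a, a, b, c].Sublist (π ++ [x]) ↔
        [a, a, b, c].Sublist π ∨ [a, a, b].Sublist π ∧ c = x :=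
      concat_sublist_concat (ρ := [a, a, b])
    simp only [containsPat_1123_iff, hs]
    constructor
    · rintro ⟨a, b, c, hab, hbc, h | ⟨h, rfl⟩⟩
      exacts [Or.inl ⟨a, b, c, hab, hbc, h⟩, Or.inr ⟨a, b, hab, hbc, h⟩]
    · rintro (⟨a, b, c, hab, hbc, h⟩ | ⟨a, b, hab, hbx, h⟩)
      exacts [⟨a, b, c, hab, hbc, Or.inl h⟩, ⟨a, b, x, hab, hbx, Or.inr ⟨h, rfl⟩⟩]
  have hneg : (∀ a b, a < b → [a, a, b].Sublist π → x ≤ b) ↔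
      ¬ ∃ a b, a < b ∧ b < x ∧ [a, a, b].Sublist π := by
    push Not
    exact forall₂_congr fun a b => by rw [← not_lt]; tauto
  rw [hneg]
  simp only [IsAvoider, AvoidsPat, key, isCanonicalSeq_concat, not_or]
  tauto

open Finset in
theorem sum_card_filter_le (A : Finset ℕ) (f : ℕ → ℕ) :
    ∑ x ∈ A, f #{y ∈ A | y ≤ x} = ∑ j ∈ range #A, f (j + 1) := by
  induction A using Finset.induction_on_max with
  | empty => simp
  | insert a s hs ih =>
    have ha : a ∉ s := fun h => lt_irrefl a (hs a h)
    rw [sum_insert ha, card_insert_of_notMem ha, sum_range_succ, ← ih, add_comm]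
    congr 1
    · refine sum_congr rfl fun x hx => ?_
      rw [filter_insert, if_neg (hs x hx).not_ge]
    · rw [filter_true_of_mem, card_insert_of_notMem ha]
      intro y hy
      rcases mem_insert.1 hy with rfl | hy
      exacts [le_rfl, (hs y hy).le]

open Classical in
/-- The letters that can be appended to `π` without creating an occurrence of 1212. -/
noncomputable def openLetters (π : List ℕ) : Finset ℕ :=
  {x ∈ Finset.Icc 1 (π.foldr max 0 + 1) | ¬ ∃ a < x, [a, x, a].Sublist π}

theorem mem_openLetters {π : List ℕ} {x : ℕ} :
    x ∈ openLetters π ↔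
      (1 ≤ x ∧ x ≤ π.foldr max 0 + 1) ∧ ¬ ∃ a < x, [a, x, a].Sublist π := by
  simp [openLetters]

open Finset in
theorem card_openLetters_concat {π : List ℕ} (h : IsCanonicalSeq π) {x : ℕ}
    (hx : x ∈ openLetters π) :
    #(openLetters (π ++ [x])) = #{y ∈ openLetters π | y ≤ x} + 1 := by
  have hx' := (mem_openLetters.1 hx).1
  have hcan : IsCanonicalSeq (π ++ [x]) := isCanonicalSeq_concat.2 ⟨h, hx'⟩
  rw [← card_insert_of_notMem (a := (π ++ [x]).foldr max 0 + 1)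
    (by rw [foldr_max_concat]; simp)]
  congr 1
  ext y
  have hs (a : ℕ) : [a, y, a].Sublist (π ++ [x]) ↔
      [a, y, a].Sublist π ∨ [a, y].Sublist π ∧ a = x := concat_sublist_concat (ρ := [a, y])
  rw [mem_insert, mem_filter, mem_openLetters, mem_openLetters]
  rcases eq_or_ne y ((π ++ [x]).foldr max 0 + 1) with hy | hy
  · have hnot : y ∉ π ++ [x] := fun hmem => by
      have := ((hcan.mem_iff y).1 hmem).2
      omega
    simp only [hy, true_or, iff_true, le_refl, and_true, le_add_iff_nonneg_left, zero_le, true_and]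
    rintro ⟨a, _, ha⟩
    exact hnot (hy ▸ ha.subset (by simp))
  · rw [foldr_max_concat] at hy ⊢
    simp only [hy, false_or, hs]
    constructor
    · rintro ⟨hy1, hno⟩
      have hyx : y ≤ x := by
        by_contra! hlt
        exact hno ⟨x, hlt, Or.inr ⟨h.pair_sublist hx'.1 hlt (by omega), rfl⟩⟩
      exact ⟨⟨by omega, fun ⟨a, hay, ha⟩ => hno ⟨a, hay, Or.inl ha⟩⟩, hyx⟩
    · rintro ⟨⟨hy1, hno⟩, hyx⟩
      refine ⟨by omega, ?_⟩
      rintro ⟨a, hay, ha | ⟨-, rfl⟩⟩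
      exacts [hno ⟨a, hay, ha⟩, by omega]

theorem extCount_1212 {π : List ℕ} (h : IsAvoider [1, 2, 1, 2] π) (n k : ℕ)
    (hk : (openLetters π).card = k + 1) :
    ExtCount (IsAvoider [1, 2, 1, 2]) π n (ballot n k) := by
  induction n generalizing π k with
  | zero => exact .zero h
  | succ n ih =>
    have hL (x : ℕ) : IsAvoider [1, 2, 1, 2] (π ++ [x]) ↔ x ∈ openLetters π := by
      rw [isAvoider_1212_concat, mem_openLetters, and_iff_right h]
    rw [ballot, ← hk, ← sum_card_filter_le (openLetters π) (ballot n)]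
    exact .succ IsAvoider.of_append _ hL fun x hx =>
      ih ((hL x).2 hx) _ (card_openLetters_concat h.1 hx)

theorem pAvoid_1212 (n : ℕ) : pAvoid n [1, 2, 1, 2] = ballot n 0 := by
  refine (extCount_1212 (isAvoider_nil (by simp)) n 0 ?_).ncard_eq
  refine Finset.card_eq_one.2 ⟨1, ?_⟩
  ext x
  simp only [mem_openLetters, Finset.mem_singleton, List.sublist_nil]
  simp
  omega

open Finset in
theorem sum_range_repeatExt (n r d : ℕ) :
    ∑ j ∈ range (r + d + 2),
        (if j ≤ r then repeatExt n j (d + (r - j)) else repeatExt n r (j - (r + 1))) =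
      repeatExt (n + 1) r d := by
  rw [show r + d + 2 = (r + 1) + (d + 1) by ring, sum_range_add, repeatExt,
    Nat.sum_antidiagonal_eq_sum_range_succ_mk]
  congr 1
  · refine sum_congr rfl fun j hj => if_pos ?_
    have := mem_range.1 hj
    omega
  · refine sum_congr rfl fun j _ => ?_
    rw [if_neg (by omega), Nat.add_sub_cancel_left]

theorem pair_sublist_concat {π : List ℕ} {a x : ℕ} :
    [a, a].Sublist (π ++ [x]) ↔ [a, a].Sublist π ∨ x ∈ π ∧ a = x := by
  have hs : [a, a].Sublist (π ++ [x]) ↔ [a, a].Sublist π ∨ [a].Sublist π ∧ a = x :=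
    concat_sublist_concat (ρ := [a])
  rw [hs, List.singleton_sublist]
  constructor <;> rintro (h | ⟨h, rfl⟩) <;> simp_all

theorem extCount_1123_of_repeat {π : List ℕ} (h : IsAvoider [1, 1, 2, 3] π) (n r d : ℕ)
    (hr : [r + 1, r + 1].Sublist π) (hmin : ∀ a, [a, a].Sublist π → r + 1 ≤ a)
    (hbound : ∀ a b, a < b → [a, a, b].Sublist π → r + d + 2 ≤ b)
    (hmax : r + d + 2 ≤ π.foldr max 0 + 1)
    (hattain : r + d + 2 = π.foldr max 0 + 1 ∨ ∃ a < r + d + 2, [a, a, r + d + 2].Sublist π) :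
    ExtCount (IsAvoider [1, 1, 2, 3]) π n (repeatExt n r d) := by
  induction n generalizing π r d with
  | zero => exact .zero h
  | succ n ih =>
    have hL (x : ℕ) : IsAvoider [1, 1, 2, 3] (π ++ [x]) ↔
        x ∈ (Finset.range (r + d + 2)).map ⟨Nat.succ, Nat.succ_injective⟩ := by
      rw [isAvoider_1123_concat, and_iff_right h]
      simp only [Finset.mem_map, Finset.mem_range, Function.Embedding.coeFn_mk]
      constructor
      · rintro ⟨hx, hle⟩
        have : x ≤ r + d + 2 := by
          rcases hattain with heq | ⟨a, hab, ha⟩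
          exacts [heq ▸ hx.2, hle a _ hab ha]
        exact ⟨x - 1, by omega, by omega⟩
      · rintro ⟨j, hj, rfl⟩
        exact ⟨by omega, fun a b hab ha => le_trans (by omega) (hbound a b hab ha)⟩
    rw [← sum_range_repeatExt]
    have := ExtCount.succ (n := n) IsAvoider.of_append
      (c := fun x => if x - 1 ≤ r then repeatExt n (x - 1) (d + (r - (x - 1)))
        else repeatExt n r (x - 1 - (r + 1))) _ hL ?_
    · simpa using this
    intro x hx
    have hav := (hL x).2 hx
    obtain ⟨j, hj, rfl⟩ := Finset.mem_map.1 hx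
    rw [Finset.mem_range] at hj
    simp only [Function.Embedding.coeFn_mk, Nat.succ_eq_add_one, Nat.add_sub_cancel] at hav ⊢
    have htriple (a b : ℕ) : [a, a, b].Sublist (π ++ [j + 1]) ↔
        [a, a, b].Sublist π ∨ [a, a].Sublist π ∧ b = j + 1 :=
      concat_sublist_concat (ρ := [a, a])
    split_ifs with hjr
    · have hmem : j + 1 ∈ π := (h.1.mem_iff _).2 (by omega)
      have hmx : (π ++ [j + 1]).foldr max 0 = π.foldr max 0 := by
        rw [foldr_max_concat]; omega
      have hB : j + (d + (r - j)) + 2 = r + d + 2 := by omega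
      apply ih hav <;> simp only [hB, hmx, pair_sublist_concat, htriple]
      · exact Or.inr ⟨hmem, trivial⟩
      · rintro a (ha | ⟨-, rfl⟩)
        · have := hmin a ha
          omega
        · exact le_rfl
      · rintro a b hab (ha | ⟨ha, rfl⟩)
        · exact hbound a b hab ha
        · have := hmin a ha
          omega
      · exact hmax
      · exact hattain.imp_right fun ⟨a, hab, ha⟩ => ⟨a, hab, Or.inl ha⟩
    · have hB : r + (j - (r + 1)) + 2 = j + 1 := by omega
      apply ih hav <;> simp only [hB, pair_sublist_concat, htriple]
      · exact Or.inl hr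
      · rintro a (ha | ⟨-, rfl⟩)
        · exact hmin a ha
        · omega
      · rintro a b hab (ha | ⟨ha, rfl⟩)
        · have := hbound a b hab ha
          omega
        · exact le_rfl
      · rw [foldr_max_concat]
        omega
      · exact Or.inr ⟨r + 1, by omega, Or.inr ⟨hr, trivial⟩⟩

theorem extCount_1123_of_nodup {π : List ℕ} (h : IsAvoider [1, 1, 2, 3] π) (hπ : π.Nodup)
    (n m : ℕ) (hm : π.foldr max 0 = m + 1) :
    ExtCount (IsAvoider [1, 1, 2, 3]) π n (iotaExt n m) := by
  have hno (a : ℕ) : ¬ [a, a].Sublist π := List.nodup_iff_sublist.1 hπ a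
  induction n generalizing π m with
  | zero => exact .zero h
  | succ n ih =>
    have hL (x : ℕ) : IsAvoider [1, 1, 2, 3] (π ++ [x]) ↔
        x ∈ (Finset.range (m + 2)).map ⟨Nat.succ, Nat.succ_injective⟩ := by
      rw [isAvoider_1123_concat, and_iff_right h]
      simp only [Finset.mem_map, Finset.mem_range, Function.Embedding.coeFn_mk]
      constructor
      · rintro ⟨hx, -⟩
        exact ⟨x - 1, by omega, by omega⟩
      · rintro ⟨j, hj, rfl⟩
        exact ⟨by omega, fun a b _ ha =>
          (hno a ((List.sublist_append_left [a, a] [b]).trans ha)).elim⟩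
    rw [iotaExt, add_comm (iotaExt n (m + 1)),
      Finset.Nat.sum_antidiagonal_eq_sum_range_succ_mk]
    have := ExtCount.succ (n := n) IsAvoider.of_append
      (c := fun x => if x ≤ m + 1 then repeatExt n (x - 1) (m - (x - 1))
        else iotaExt n (m + 1)) _ hL ?_
    · convert this using 1
      rw [Finset.sum_map, Finset.sum_range_succ _ (m + 1)]
      simp only [Function.Embedding.coeFn_mk, Nat.succ_eq_add_one, Nat.add_sub_cancel]
      rw [if_neg (by omega)]
      congr 1
      refine Finset.sum_congr rfl fun j hj => (if_pos ?_).symm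
      have := Finset.mem_range.1 hj
      omega
    intro x hx
    have hav := (hL x).2 hx
    obtain ⟨j, hj, rfl⟩ := Finset.mem_map.1 hx
    rw [Finset.mem_range] at hj
    simp only [Function.Embedding.coeFn_mk, Nat.succ_eq_add_one, Nat.add_sub_cancel] at hav ⊢
    split_ifs with hjm
    · have hmem : j + 1 ∈ π := (h.1.mem_iff _).2 (by omega)
      have hB : j + (m - j) + 2 = m + 2 := by omega
      have hmx : (π ++ [j + 1]).foldr max 0 = m + 1 := by
        rw [foldr_max_concat]; omega
      have htriple (a b : ℕ) : [a, a, b].Sublist (π ++ [j + 1]) ↔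
          [a, a, b].Sublist π ∨ [a, a].Sublist π ∧ b = j + 1 :=
        concat_sublist_concat (ρ := [a, a])
      apply extCount_1123_of_repeat hav <;>
        simp only [hB, hmx, pair_sublist_concat, htriple, hno, false_or, false_and, or_false]
      · exact ⟨hmem, trivial⟩
      · rintro a ⟨-, rfl⟩
        exact le_rfl
      · exact fun a b _ ha => (hno a ((List.sublist_append_left [a, a] [b]).trans ha)).elim
      · exact le_rfl
      · exact Or.inl trivial
    · have hmem : j + 1 ∉ π := fun hmem => by
        have := ((h.1.mem_iff _).1 hmem).2
        omega
      have hnodup : (π ++ [j + 1]).Nodup := by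
        rw [List.nodup_append]
        simp only [hπ, List.nodup_singleton, true_and, List.mem_singleton]
        rintro a ha _ rfl rfl
        exact hmem ha
      exact ih hav hnodup (m + 1) (by rw [foldr_max_concat]; omega)
        (List.nodup_iff_sublist.1 hnodup)

theorem pAvoid_1123 (n : ℕ) : pAvoid n [1, 1, 2, 3] = ballot n 0 := by
  have h : IsAvoider [1, 1, 2, 3] [] := isAvoider_nil (by simp)
  refine ExtCount.ncard_eq ?_
  cases n with
  | zero => exact .zero h
  | succ n =>
    have hL (x : ℕ) : IsAvoider [1, 1, 2, 3] ([] ++ [x]) ↔ x ∈ ({1} : Finset ℕ) := by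
      rw [isAvoider_1123_concat, and_iff_right h]
      simp
      omega
    rw [← iotaExt_zero_right, ← Finset.sum_singleton (fun _ => iotaExt n 0) 1]
    refine .succ IsAvoider.of_append _ hL fun x hx => ?_
    refine extCount_1123_of_nodup ((hL x).2 hx) (by simp) n 0 ?_
    simp [Finset.mem_singleton.1 hx]

/-- For every n, the number of partitions of [n] avoiding 1123
equals the n-th Catalan number C(2n, n)/(n+1); consequently 1123 ∼ 1212. -/
theorem statement16 :
    (∀ n : ℕ, pAvoid n [1, 1, 2, 3] = Nat.choose (2 * n) n / (n + 1)) ∧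
    (∀ n : ℕ, pAvoid n [1, 1, 2, 3] = pAvoid n [1, 2, 1, 2]) :=
  ⟨fun n => by rw [pAvoid_1123, ballot_zero_right], fun n => by rw [pAvoid_1123, pAvoid_1212]⟩
end
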